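/- Let γ : I → R³ be smooth with γ'(t₀) = 0 and γ''(t₀), γ'''(t₀), γ''''(t₀) linearly independent, and suppose γ'(t) = c(t)u(t) with u smooth, u(t₀) ≠ 0, and c(t₀)=0, c'(t₀)≠0. Then the tangent surface f(t,s) = γ(t) + s u(t), as a germ at (t₀,0), is diffeomorphic to the swallowtail (u,t) ↦ (u, t³+ut, t⁴+(2/3)ut²). -/

import Mathlib

/-- `f` (as a germ at `p`) is diffeomorphic to `g` (as a germ at `q`): there are
diffeomorphism-germs `σ` of the source and `τ` of the target with `τ ∘ f = g ∘ σ`. -/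
def LocallyDiffeomorphic {E F : Type*} [NormedAddCommGroup E] [NormedSpace ℝ E]
    [NormedAddCommGroup F] [NormedSpace ℝ F]
    (f : E → F) (p : E) (g : E → F) (q : E) : Prop :=
  ∃ (σ σi : E → E) (τ τi : F → F) (U : Set E) (W : Set F),
    IsOpen U ∧ p ∈ U ∧ IsOpen W ∧ f p ∈ W ∧
    ContDiffOn ℝ (⊤ : ℕ∞) σ U ∧ ContDiffOn ℝ (⊤ : ℕ∞) τ W ∧
    (∀ x ∈ U, σi (σ x) = x) ∧ (∀ y ∈ W, τi (τ y) = y) ∧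
    ContDiffOn ℝ (⊤ : ℕ∞) σi (σ '' U) ∧ ContDiffOn ℝ (⊤ : ℕ∞) τi (τ '' W) ∧
    σ p = q ∧ f '' U ⊆ W ∧ ∀ x ∈ U, τ (f x) = g (σ x)

namespace SwallowtailGerm

open Set Filter Topology MeasureTheory Function
open scoped ContDiff

section TemperateGrowth

variable {E F G : Type*} [NormedAddCommGroup E] [NormedSpace ℝ E]
  [NormedAddCommGroup F] [NormedSpace ℝ F] [NormedAddCommGroup G] [NormedSpace ℝ G]

@[fun_prop]
lemma hasTemperateGrowth_prodMk {f : E → F} {g : E → G} (hf : f.HasTemperateGrowth)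
    (hg : g.HasTemperateGrowth) : (fun x => (f x, g x)).HasTemperateGrowth := by
  have h := ((ContinuousLinearMap.inl ℝ F G).hasTemperateGrowth.comp hf).add
    ((ContinuousLinearMap.inr ℝ F G).hasTemperateGrowth.comp hg)
  convert h using 1
  ext x <;> simp

@[fun_prop]
lemma hasTemperateGrowth_fst {f : E → F × G} (hf : f.HasTemperateGrowth) :
    (fun x => (f x).1).HasTemperateGrowth :=
  (ContinuousLinearMap.fst ℝ F G).hasTemperateGrowth.comp hf

@[fun_prop]
lemma hasTemperateGrowth_snd {f : E → F × G} (hf : f.HasTemperateGrowth) :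
    (fun x => (f x).2).HasTemperateGrowth :=
  (ContinuousLinearMap.snd ℝ F G).hasTemperateGrowth.comp hf

@[fun_prop]
lemma hasTemperateGrowth_apply {n : ℕ} (i : Fin n) :
    (fun v : Fin n → ℝ => v i).HasTemperateGrowth :=
  (ContinuousLinearMap.proj (R := ℝ) (φ := fun _ : Fin n => ℝ) i).hasTemperateGrowth

@[fun_prop]
lemma hasTemperateGrowth_ofReal {f : E → ℝ} (hf : f.HasTemperateGrowth) :
    (fun x => (f x : ℂ)).HasTemperateGrowth :=
  Complex.ofRealCLM.hasTemperateGrowth.comp hf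

@[fun_prop]
lemma hasTemperateGrowth_conj {f : E → ℂ} (hf : f.HasTemperateGrowth) :
    (fun x => (starRingEnd ℂ) (f x)).HasTemperateGrowth :=
  (Complex.conjCLE : ℂ ≃L[ℝ] ℂ).hasTemperateGrowth.comp hf

@[fun_prop]
lemma hasTemperateGrowth_normSq {f : E → ℂ} (hf : f.HasTemperateGrowth) :
    (fun x => ‖f x‖ ^ 2).HasTemperateGrowth :=
  (Function.hasTemperateGrowth_norm_sq ℂ).comp hf

lemma hasTemperateGrowth_fderiv {f : E → F} (hf : f.HasTemperateGrowth) :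
    (fderiv ℝ f).HasTemperateGrowth := by
  refine ⟨hf.1.fderiv_right (by simp), fun n => ?_⟩
  obtain ⟨k, C, h⟩ := hf.2 (n + 1)
  exact ⟨k, C, fun x => by rw [norm_iteratedFDeriv_fderiv]; exact h x⟩

/-- A smooth function on `ℝ` agreeing with `y⁻¹` for `1 ≤ y` and vanishing for `y ≤ 1 / 2`. -/
noncomputable def cutoffInv (y : ℝ) : ℝ := Real.smoothTransition (2 * y - 1) * y⁻¹

lemma cutoffInv_of_one_le {y : ℝ} (hy : 1 ≤ y) : cutoffInv y = y⁻¹ := by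
  rw [cutoffInv, Real.smoothTransition.one_of_one_le (by linarith), one_mul]

lemma cutoffInv_of_le_half {y : ℝ} (hy : y ≤ 1 / 2) : cutoffInv y = 0 := by
  rw [cutoffInv, Real.smoothTransition.zero_of_nonpos (by linarith), zero_mul]

lemma cutoffInv_nonneg (y : ℝ) : 0 ≤ cutoffInv y := by
  rcases le_total y (1 / 2) with hy | hy
  · rw [cutoffInv_of_le_half hy]
  · exact mul_nonneg (Real.smoothTransition.nonneg _) (inv_nonneg.2 (by linarith))

lemma contDiff_cutoffInv : ContDiff ℝ ∞ cutoffInv := by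
  rw [contDiff_iff_contDiffAt]
  intro y
  rcases lt_or_ge y (1 / 2) with hy | hy
  · have : cutoffInv =ᶠ[𝓝 y] fun _ => 0 := by
      filter_upwards [gt_mem_nhds hy] with z hz using cutoffInv_of_le_half hz.le
    exact contDiffAt_const.congr_of_eventuallyEq this
  · refine ContDiffAt.mul (Real.smoothTransition.contDiffAt.comp y (by fun_prop)) ?_
    exact contDiffAt_inv ℝ (by linarith)

lemma hasTemperateGrowth_cutoffInv : cutoffInv.HasTemperateGrowth := by
  refine ⟨contDiff_cutoffInv, fun n => ?_⟩
  have hcont : Continuous (iteratedDeriv n cutoffInv) :=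
    contDiff_cutoffInv.continuous_iteratedDeriv n (mod_cast le_top)
  obtain ⟨C, hC⟩ := (isCompact_Icc (a := (0 : ℝ)) (b := 2)).exists_bound_of_continuousOn
    hcont.continuousOn
  refine ⟨0, max C n.factorial, fun y => ?_⟩
  rw [norm_iteratedFDeriv_eq_norm_iteratedDeriv, pow_zero, mul_one]
  rcases lt_or_ge y 0 with h0 | h0
  · have : cutoffInv =ᶠ[𝓝 y] fun _ => 0 := by
      filter_upwards [gt_mem_nhds h0] with z hz using cutoffInv_of_le_half (by linarith)
    rw [this.iteratedDeriv_eq]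
    simp
  rcases le_or_gt y 2 with h2 | h2
  · exact (hC y ⟨h0, h2⟩).trans (le_max_left _ _)
  · have : cutoffInv =ᶠ[𝓝 y] fun z => z⁻¹ := by
      filter_upwards [lt_mem_nhds h2] with z hz using cutoffInv_of_one_le (by linarith)
    rw [this.iteratedDeriv_eq, iteratedDeriv_eq_iterate, iter_deriv_inv]
    refine le_trans ?_ (le_max_right _ _)
    rw [norm_mul, norm_mul, norm_pow, norm_neg, norm_one, one_pow, one_mul]
    have h1 : ‖y ^ (-1 - n : ℤ)‖ ≤ 1 := by
      rw [Real.norm_of_nonneg (by positivity)]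
      exact zpow_le_one_of_nonpos₀ (by linarith) (by lia)
    calc _ ≤ ‖(n.factorial : ℝ)‖ * 1 := by gcongr
      _ = _ := by simp

@[fun_prop]
lemma hasTemperateGrowth_cutoffInv_comp {f : E → ℝ} (hf : f.HasTemperateGrowth) :
    (fun x => cutoffInv (f x)).HasTemperateGrowth :=
  hasTemperateGrowth_cutoffInv.comp hf

end TemperateGrowth

section ParametricIntegral

/-- Smoothness of parametric integrals whose kernel is of temperate growth, against a weight that
is integrable against all powers. -/
lemma contDiff_integral_of_hasTemperateGrowth {E X : Type} [NormedAddCommGroup E]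
    [NormedSpace ℝ E] [NormedAddCommGroup X] [NormedSpace ℝ X] [MeasurableSpace X]
    [BorelSpace X] [SecondCountableTopology X] {ν : Measure X}
    {A : X → ℂ} (hA : AEStronglyMeasurable A ν)
    (hint : ∀ N : ℕ, Integrable (fun x => (1 + ‖x‖) ^ N * ‖A x‖) ν)
    {Φ : E × X → ℂ} (hΦ : Φ.HasTemperateGrowth) :
    (∀ y, Integrable (fun x => A x * Φ (y, x)) ν) ∧
      ContDiff ℝ ∞ (fun y => ∫ x, A x * Φ (y, x) ∂ν) := by
  have key : ∀ {B : Type} [NormedAddCommGroup B] [NormedSpace ℂ B] (Ψ : E × X → B),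
      Ψ.HasTemperateGrowth → ∀ y, Integrable (fun x => A x • Ψ (y, x)) ν := by
    intro B _ _ Ψ hΨ y
    obtain ⟨N, C, h⟩ := hΨ.2 0
    simp only [norm_iteratedFDeriv_zero] at h
    refine ((hint N).const_mul (C * (1 + ‖y‖) ^ N)).mono' ?_ ?_
    · exact hA.smul (hΨ.1.continuous.comp (by fun_prop)).aestronglyMeasurable
    · filter_upwards with x
      have hC : 0 ≤ C := by
        have := (norm_nonneg _).trans (h 0)
        simpa using this
      have h1 : 1 + ‖(y, x)‖ ≤ (1 + ‖y‖) * (1 + ‖x‖) := by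
        rw [Prod.norm_mk]
        have := norm_nonneg y
        have := norm_nonneg x
        rcases max_cases ‖y‖ ‖x‖ with ⟨h, -⟩ | ⟨h, -⟩ <;> rw [h] <;> nlinarith
      rw [norm_smul]
      calc ‖A x‖ * ‖Ψ (y, x)‖ ≤ ‖A x‖ * (C * ((1 + ‖y‖) * (1 + ‖x‖)) ^ N) := by
            gcongr
            exact (h _).trans (by gcongr)
        _ = _ := by rw [mul_pow]; ring
  refine ⟨fun y => key Φ hΦ y, ?_⟩
  rw [contDiff_infty]
  intro n
  suffices H : ∀ (n : ℕ) {B : Type} [NormedAddCommGroup B] [NormedSpace ℂ B]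
      (Ψ : E × X → B), Ψ.HasTemperateGrowth → ContDiff ℝ n (fun y => ∫ x, A x • Ψ (y, x) ∂ν) from
    H n Φ hΦ
  clear n
  have hder : ∀ {B : Type} [NormedAddCommGroup B] [NormedSpace ℂ B]
      (Ψ : E × X → B), Ψ.HasTemperateGrowth → ∀ y, HasFDerivAt (fun y => ∫ x, A x • Ψ (y, x) ∂ν)
        (∫ x, A x • (fderiv ℝ Ψ (y, x)).comp (ContinuousLinearMap.inl ℝ E X) ∂ν) y := by
    intro B _ _ Ψ hΨ y
    have hΨ' : (fun p => (fderiv ℝ Ψ p).comp (ContinuousLinearMap.inl ℝ E X)).HasTemperateGrowth :=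
      ((ContinuousLinearMap.compL ℝ E (E × X) B).flip
        (ContinuousLinearMap.inl ℝ E X)).hasTemperateGrowth.comp (hasTemperateGrowth_fderiv hΨ)
    obtain ⟨N, C, h⟩ := hΨ'.2 0
    simp only [norm_iteratedFDeriv_zero] at h
    have hC : 0 ≤ C := by
      have := (norm_nonneg _).trans (h 0)
      simpa using this
    refine hasFDerivAt_integral_of_dominated_of_fderiv_le (𝕜 := ℝ) (s := Metric.ball y 1)
      (F := fun y x => A x • Ψ (y, x))
      (F' := fun y x => A x • (fderiv ℝ Ψ (y, x)).comp (ContinuousLinearMap.inl ℝ E X))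
      (bound := fun x => C * (2 + ‖y‖) ^ N * ((1 + ‖x‖) ^ N * ‖A x‖))
      (Metric.ball_mem_nhds y one_pos) ?_ (key Ψ hΨ y) ?_ ?_ ((hint N).const_mul _) ?_
    · exact Eventually.of_forall fun y' => (key Ψ hΨ y').aestronglyMeasurable
    · exact (key _ hΨ' y).aestronglyMeasurable
    · filter_upwards with x y' hy'
      have h1 : 1 + ‖(y', x)‖ ≤ (2 + ‖y‖) * (1 + ‖x‖) := by
        have h2 : ‖y'‖ ≤ 1 + ‖y‖ := by
          have := norm_sub_norm_le y' y
          rw [Metric.mem_ball, dist_eq_norm] at hy'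
          linarith
        rw [Prod.norm_mk]
        have := norm_nonneg y
        have := norm_nonneg x
        rcases max_cases ‖y'‖ ‖x‖ with ⟨h, -⟩ | ⟨h, -⟩ <;> rw [h] <;> nlinarith
      rw [norm_smul]
      calc _ ≤ ‖A x‖ * (C * ((2 + ‖y‖) * (1 + ‖x‖)) ^ N) := by
            gcongr
            exact (h _).trans (by gcongr)
        _ = _ := by rw [mul_pow]; ring
    · filter_upwards with x y' _
      have h1 : HasFDerivAt Ψ (fderiv ℝ Ψ (y', x)) (y', x) :=
        (hΨ.1.differentiable (by simp) _).hasFDerivAt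
      have h2 : HasFDerivAt (fun y : E => (y, x)) (ContinuousLinearMap.inl ℝ E X) y' :=
        hasFDerivAt_prodMk_left y' x
      exact (h1.comp y' h2).const_smul (A x)
  intro n
  induction n with
  | zero =>
    intro B _ _ Ψ hΨ
    exact contDiff_zero.2 (continuous_iff_continuousAt.2 fun y => (hder Ψ hΨ y).continuousAt)
  | succ n ih =>
    intro B _ _ Ψ hΨ
    rw [show ((n + 1 : ℕ) : WithTop ℕ∞) = (n : WithTop ℕ∞) + 1 by simp,
      contDiff_succ_iff_hasFDerivAt]
    exact ⟨_, ih (fun p => (fderiv ℝ Ψ p).comp (ContinuousLinearMap.inl ℝ E X))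
      (((ContinuousLinearMap.compL ℝ E (E × X) B).flip
        (ContinuousLinearMap.inl ℝ E X)).hasTemperateGrowth.comp (hasTemperateGrowth_fderiv hΨ)),
      hder Ψ hΨ⟩

end ParametricIntegral

section Weights

open Polynomial in
/-- The generic monic quartic. -/
noncomputable def genericQuartic : (MvPolynomial (Fin 4) ℂ)[X] :=
  X ^ 4 + C (MvPolynomial.X 3) * X ^ 3 + C (MvPolynomial.X 2) * X ^ 2 + C (MvPolynomial.X 1) * X
    + C (MvPolynomial.X 0)

/-- The monic quartic with real lower coefficients `l`, evaluated at `z`. -/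
def quartic {K : Type*} [CommRing K] [Algebra ℝ K] (l : Fin 4 → ℝ) (z : K) : K :=
  z ^ 4 + algebraMap ℝ K (l 3) * z ^ 3 + algebraMap ℝ K (l 2) * z ^ 2
    + algebraMap ℝ K (l 1) * z + algebraMap ℝ K (l 0)

/-- Specialisation of the coefficients of the generic quartic. -/
noncomputable def specialize (l : Fin 4 → ℝ) : MvPolynomial (Fin 4) ℂ →+* ℂ :=
  MvPolynomial.eval fun j => (l j : ℂ)

/-- The generic quartic translated by `a`. -/
noncomputable def shiftedQuartic (a : ℂ) : Polynomial (MvPolynomial (Fin 4) ℂ) :=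
  genericQuartic.comp (Polynomial.X + Polynomial.C (MvPolynomial.C a))

lemma natDegree_genericQuartic_le : genericQuartic.natDegree ≤ 4 := by
  unfold genericQuartic
  compute_degree

lemma natDegree_shiftedQuartic_le (a : ℂ) : (shiftedQuartic a).natDegree ≤ 4 := by
  refine Polynomial.natDegree_comp_le.trans ?_
  rw [Polynomial.natDegree_X_add_C, mul_one]
  exact natDegree_genericQuartic_le

lemma eval_map_genericQuartic (l : Fin 4 → ℝ) (z : ℂ) :
    (genericQuartic.map (specialize l)).eval z = quartic l z := by
  simp [genericQuartic, specialize, quartic]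

lemma monic_map_genericQuartic (l : Fin 4 → ℝ) :
    (genericQuartic.map (specialize l)).Monic := by
  simp only [genericQuartic, specialize, Polynomial.map_add, Polynomial.map_mul,
    Polynomial.map_pow, Polynomial.map_X, Polynomial.map_C]
  monicity!

lemma natDegree_map_genericQuartic (l : Fin 4 → ℝ) :
    (genericQuartic.map (specialize l)).natDegree = 4 := by
  simp only [genericQuartic, specialize, Polynomial.map_add, Polynomial.map_mul,
    Polynomial.map_pow, Polynomial.map_X, Polynomial.map_C]
  compute_degree!

lemma map_shiftedQuartic (a : ℂ) (l : Fin 4 → ℝ) :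
    (shiftedQuartic a).map (specialize l)
      = (genericQuartic.map (specialize l)).comp (Polynomial.X + Polynomial.C a) := by
  simp [shiftedQuartic, Polynomial.map_comp, specialize]

lemma eval_map_shiftedQuartic (a : ℂ) (l : Fin 4 → ℝ) (z : ℂ) :
    ((shiftedQuartic a).map (specialize l)).eval z = quartic l (z + a) := by
  rw [map_shiftedQuartic, Polynomial.eval_comp, eval_map_genericQuartic]
  simp

lemma monic_map_shiftedQuartic (a : ℂ) (l : Fin 4 → ℝ) :
    ((shiftedQuartic a).map (specialize l)).Monic := by
  rw [map_shiftedQuartic]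
  exact (monic_map_genericQuartic l).comp_X_add_C a

lemma natDegree_map_shiftedQuartic (a : ℂ) (l : Fin 4 → ℝ) :
    ((shiftedQuartic a).map (specialize l)).natDegree = 4 := by
  rw [map_shiftedQuartic, Polynomial.natDegree_comp, natDegree_map_genericQuartic,
    Polynomial.natDegree_X_add_C]

/-- The resultant of `P(X + iη)` and `P(X - iη)`, where `P` is the quartic with coefficients `l`:
it vanishes when `P` has conjugate roots on the lines `Im z = ± η`. -/
noncomputable def lineResultant (η : ℝ) (l : Fin 4 → ℝ) : ℂ :=
  specialize l ((shiftedQuartic (Complex.I * η)).resultant (shiftedQuartic (-(Complex.I * η))) 4 4)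

lemma hasTemperateGrowth_specialize (q : MvPolynomial (Fin 4) ℂ) :
    (fun l => specialize l q).HasTemperateGrowth := by
  unfold specialize
  induction q using MvPolynomial.induction_on with
  | C a => simp
  | add p q hp hq => simpa using hp.fun_add hq
  | mul_X p j hp => simp only [map_mul, MvPolynomial.eval_X]; fun_prop

lemma hasTemperateGrowth_eval_map_specialize (q : Polynomial (MvPolynomial (Fin 4) ℂ)) :
    (fun p : ℝ × (Fin 4 → ℝ) => (q.map (specialize p.2)).eval (p.1 : ℂ)).HasTemperateGrowth := by
  induction q using Polynomial.induction_on' with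
  | add p q hp hq => simpa using hp.fun_add hq
  | monomial n a =>
    have := (hasTemperateGrowth_specialize a).comp
      (ContinuousLinearMap.snd ℝ ℝ (Fin 4 → ℝ)).hasTemperateGrowth
    simp only [Polynomial.map_monomial, Polynomial.eval_monomial]
    exact this.mul (by fun_prop)

lemma conj_quartic (l : Fin 4 → ℝ) (z : ℂ) :
    (starRingEnd ℂ) (quartic l z) = quartic l ((starRingEnd ℂ) z) := by
  simp [quartic]

lemma exists_norm_lineResultant_le (η : ℝ) :
    ∃ M : ℝ × (Fin 4 → ℝ) → ℝ, M.HasTemperateGrowth ∧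
      ∀ x l, ‖lineResultant η l‖ ^ 2 ≤ M (x, l) * ‖quartic l (x + Complex.I * η : ℂ)‖ ^ 2 := by
  obtain ⟨p, q, -, -, h⟩ := Polynomial.exists_mul_add_mul_eq_C_resultant
    (shiftedQuartic (Complex.I * η)) (shiftedQuartic (-(Complex.I * η)))
    (natDegree_shiftedQuartic_le _) (natDegree_shiftedQuartic_le _) (by simp)
  have hp := hasTemperateGrowth_eval_map_specialize p
  have hq := hasTemperateGrowth_eval_map_specialize q
  refine ⟨fun y => 2 * (‖(p.map (specialize y.2)).eval (y.1 : ℂ)‖ ^ 2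
    + ‖(q.map (specialize y.2)).eval (y.1 : ℂ)‖ ^ 2), by fun_prop, fun x l => ?_⟩
  have h1 := congrArg (fun r => (r.map (specialize l)).eval (x : ℂ)) h
  simp only [Polynomial.map_add, Polynomial.map_mul, Polynomial.eval_add, Polynomial.eval_mul,
    eval_map_shiftedQuartic, Polynomial.map_C, Polynomial.eval_C] at h1
  rw [← lineResultant] at h1
  have h2 : ‖quartic l (x + -(Complex.I * η) : ℂ)‖ = ‖quartic l (x + Complex.I * η : ℂ)‖ := by
    rw [← Complex.norm_conj, conj_quartic]
    simp
  rw [← h1]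
  set a := Polynomial.eval (x : ℂ) (p.map (specialize l))
  set b := Polynomial.eval (x : ℂ) (q.map (specialize l))
  have h3 := norm_add_le (quartic l (x + Complex.I * η : ℂ) * a)
    (quartic l (x + -(Complex.I * η) : ℂ) * b)
  rw [norm_mul, norm_mul, h2, ← mul_add] at h3
  calc _ ≤ (‖quartic l (x + Complex.I * η : ℂ)‖ * (‖a‖ + ‖b‖)) ^ 2 := by gcongr
    _ ≤ _ := by
      rw [mul_pow, mul_comm]
      gcongr
      nlinarith [sq_nonneg (‖a‖ - ‖b‖)]

lemma one_le_norm_multiset_prod (s : Multiset ℂ) (h : ∀ z ∈ s, 1 ≤ ‖z‖) : 1 ≤ ‖s.prod‖ := by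
  induction s using Multiset.induction_on with
  | empty => simp
  | cons a s ih =>
    rw [Multiset.prod_cons, norm_mul]
    exact one_le_mul_of_one_le_of_one_le (h a (by simp)) (ih fun z hz => h z (by simp [hz]))

/-- The heights of the horizontal contours. -/
def height (m : Fin 17) : ℝ := m + 1

lemma one_le_height (m : Fin 17) : 1 ≤ height m := by
  unfold height
  linarith [Nat.cast_nonneg (α := ℝ) (m : ℕ)]

lemma exists_one_le_norm_lineResultant (l : Fin 4 → ℝ) :
    ∃ m : Fin 17, 1 ≤ ‖lineResultant (height m) l‖ := by
  set S := (genericQuartic.map (specialize l)).roots.toFinset with hS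
  have hcard : S.card ≤ 4 :=
    (Multiset.toFinset_card_le _).trans ((Polynomial.card_roots' _).trans
      (natDegree_map_genericQuartic l).le)
  have hm : ∃ m : Fin 17, ∀ z ∈ S, ∀ w ∈ S, 1 ≤ |z.im - w.im - 2 * height m| := by
    by_contra! H
    choose z hz w hw hzw using H
    have hmap : ∀ m ∈ (Finset.univ : Finset (Fin 17)), (z m, w m) ∈ S ×ˢ S :=
      fun m _ => Finset.mem_product.2 ⟨hz m, hw m⟩
    obtain ⟨m, -, m', -, hne, heq⟩ := Finset.exists_ne_map_eq_of_card_lt_of_maps_to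
      (by rw [Finset.card_product, Finset.card_univ, Fintype.card_fin]; nlinarith) hmap
    simp only [Prod.mk.injEq] at heq
    have h1 := abs_lt.1 (hzw m)
    have h2 := abs_lt.1 (hzw m')
    rw [heq.1, heq.2] at h1
    unfold height at h1 h2
    have h3 : (m : ℝ) < m' + 1 := by linarith
    have h4 : (m' : ℝ) < m + 1 := by linarith
    apply hne
    ext
    have h5 : (m : ℕ) < m' + 1 := by exact_mod_cast h3
    have h6 : (m' : ℕ) < m + 1 := by exact_mod_cast h4
    omega
  obtain ⟨m, hm⟩ := hm
  refine ⟨m, ?_⟩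
  set a : ℂ := Complex.I * height m with ha
  have hres : lineResultant (height m) l =
      (((shiftedQuartic a).map (specialize l)).resultant
        ((shiftedQuartic (-a)).map (specialize l))) := by
    rw [natDegree_map_shiftedQuartic, natDegree_map_shiftedQuartic,
      Polynomial.resultant_map_map]
    rfl
  have hroot : ∀ (b z : ℂ), z ∈ ((shiftedQuartic b).map (specialize l)).roots → z + b ∈ S := by
    intro b z hz
    rw [Polynomial.mem_roots (monic_map_shiftedQuartic b l).ne_zero, Polynomial.IsRoot,
      eval_map_shiftedQuartic] at hz
    rw [hS, Multiset.mem_toFinset, Polynomial.mem_roots (monic_map_genericQuartic l).ne_zero,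
      Polynomial.IsRoot, eval_map_genericQuartic, hz]
  rw [hres, Polynomial.resultant_eq_prod_roots_sub _ _ (monic_map_shiftedQuartic _ _)
    (monic_map_shiftedQuartic _ _) (IsAlgClosed.splits _) (IsAlgClosed.splits _)]
  refine one_le_norm_multiset_prod _ fun v hv => ?_
  obtain ⟨⟨z, w⟩, hzw, rfl⟩ := Multiset.mem_map.1 hv
  rw [Multiset.mem_product] at hzw
  have h := hm _ (hroot _ _ hzw.1) _ (hroot _ _ hzw.2)
  refine (h.trans ?_).trans (Complex.abs_im_le_norm _)
  apply le_of_eq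
  congr 1
  simp [ha]
  ring

lemma hasTemperateGrowth_quartic (a : ℂ) :
    (fun p : ℝ × (Fin 4 → ℝ) => quartic p.2 (p.1 + a : ℂ)).HasTemperateGrowth := by
  simp only [quartic, Complex.coe_algebraMap]
  have h : ∀ j : Fin 4,
      (fun p : ℝ × (Fin 4 → ℝ) => ((p.2 j : ℝ) : ℂ)).HasTemperateGrowth := fun j =>
    hasTemperateGrowth_ofReal ((hasTemperateGrowth_apply j).comp
      (ContinuousLinearMap.snd ℝ ℝ (Fin 4 → ℝ)).hasTemperateGrowth)
  have hz : (fun p : ℝ × (Fin 4 → ℝ) => (p.1 + a : ℂ)).HasTemperateGrowth := by fun_prop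
  have h2 := hz.mul hz
  have h3 := h2.mul hz
  have h4 := h3.mul hz
  have h := (((h4.add ((h 3).mul h3)).add ((h 2).mul h2)).add ((h 1).mul hz)).add (h 0)
  refine (congrArg Function.HasTemperateGrowth (funext fun p => ?_)).mpr h
  simp only [Pi.add_apply, Pi.mul_apply]
  ring

/-- For each real quartic, smooth weights on the horizontal contours that vanish on the contours
too close to its roots. The weighted reciprocals of the quartic have temperate growth. -/
lemma exists_contour_weights :
    ∃ (w : Fin 17 → (Fin 4 → ℝ) → ℝ) (G : Fin 17 → ℝ × (Fin 4 → ℝ) → ℂ),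
      (∀ m, (G m).HasTemperateGrowth) ∧ (∀ l, ∑ m, w m l = 1) ∧
      ∀ m (x : ℝ) l, quartic l ((x : ℂ) + Complex.I * height m) * G m (x, l) = w m l := by
  choose M hM hle using fun m : Fin 17 => exists_norm_lineResultant_le (height m)
  have hD : ∀ m : Fin 17, (fun l => lineResultant (height m) l).HasTemperateGrowth :=
    fun m => hasTemperateGrowth_specialize _
  let χ : Fin 17 → (Fin 4 → ℝ) → ℝ := fun m l =>
    ‖lineResultant (height m) l‖ ^ 2 * cutoffInv (‖lineResultant (height m) l‖ ^ 2)
  have hχ0 : ∀ m l, 0 ≤ χ m l := fun m l => mul_nonneg (by positivity) (cutoffInv_nonneg _)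
  have hχ1 : ∀ l, 1 ≤ ∑ m, χ m l := by
    intro l
    obtain ⟨m, hm⟩ := exists_one_le_norm_lineResultant l
    have h1 : 1 ≤ ‖lineResultant (height m) l‖ ^ 2 := one_le_pow₀ hm
    have h2 : χ m l = 1 := by
      simp only [χ]
      rw [cutoffInv_of_one_le h1, mul_inv_cancel₀ (by positivity)]
    rw [← h2]
    exact Finset.single_le_sum (f := fun m => χ m l) (fun m _ => hχ0 m l) (Finset.mem_univ m)
  have hχ : ∀ m, (χ m).HasTemperateGrowth := by
    intro m
    have := hasTemperateGrowth_normSq (hD m)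
    exact this.mul (hasTemperateGrowth_cutoffInv_comp this)
  let w : Fin 17 → (Fin 4 → ℝ) → ℝ := fun m l => χ m l * cutoffInv (∑ m, χ m l)
  have hw : ∀ m, (w m).HasTemperateGrowth := by
    intro m
    have h2 : (fun l => ∑ m, χ m l).HasTemperateGrowth :=
      Function.HasTemperateGrowth.sum fun m _ => hχ m
    exact (hχ m).mul (hasTemperateGrowth_cutoffInv_comp h2)
  have hw' : ∀ m, (fun p : ℝ × (Fin 4 → ℝ) => w m p.2).HasTemperateGrowth := fun m =>
    (hw m).comp (ContinuousLinearMap.snd ℝ ℝ (Fin 4 → ℝ)).hasTemperateGrowth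
  let P : Fin 17 → ℝ × (Fin 4 → ℝ) → ℂ := fun m p => quartic p.2 (p.1 + Complex.I * height m : ℂ)
  have hP : ∀ m, (P m).HasTemperateGrowth := fun m => hasTemperateGrowth_quartic _
  refine ⟨w, fun m p => (w m p.2 : ℂ) * ((starRingEnd ℂ) (P m p) *
    ((2 * M m p * cutoffInv (2 * M m p * ‖P m p‖ ^ 2) : ℝ) : ℂ)), fun m => ?_, fun l => ?_,
    fun m x l => ?_⟩
  · have h1 : (fun p => 2 * M m p).HasTemperateGrowth :=
      (Function.HasTemperateGrowth.const 2).mul (hM m)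
    have h2 := hasTemperateGrowth_cutoffInv_comp (h1.mul (hasTemperateGrowth_normSq (hP m)))
    exact (hasTemperateGrowth_ofReal (hw' m)).mul
      ((hasTemperateGrowth_conj (hP m)).mul (hasTemperateGrowth_ofReal (h1.mul h2)))
  · simp only [w]
    rw [← Finset.sum_mul, cutoffInv_of_one_le (hχ1 l), mul_inv_cancel₀]
    linarith [hχ1 l]
  · change P m (x, l) * _ = _
    rcases eq_or_ne (w m l) 0 with h0 | h0
    · simp [h0]
    have h1 : 1 / 2 < ‖lineResultant (height m) l‖ ^ 2 := by
      by_contra! hcon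
      apply h0
      simp only [w, χ]
      rw [cutoffInv_of_le_half hcon]
      simp
    have h2 : 1 ≤ 2 * M m (x, l) * ‖P m (x, l)‖ ^ 2 := by
      have := hle m x l
      simp only [P]
      linarith
    have h3 : P m (x, l) * (starRingEnd ℂ) (P m (x, l)) = ((‖P m (x, l)‖ ^ 2 : ℝ) : ℂ) := by
      rw [Complex.mul_conj, Complex.normSq_eq_norm_sq]
    calc _ = (w m l : ℂ) * ((P m (x, l) * (starRingEnd ℂ) (P m (x, l))) *
        ((2 * M m (x, l) * cutoffInv (2 * M m (x, l) * ‖P m (x, l)‖ ^ 2) : ℝ) : ℂ)) := by ring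
      _ = _ := by
        rw [h3, ← Complex.ofReal_mul, ← Complex.ofReal_mul, cutoffInv_of_one_le h2]
        congr 1
        have h4 : 2 * M m (x, l) * ‖P m (x, l)‖ ^ 2 ≠ 0 := by linarith
        calc _ = w m l * ((2 * M m (x, l) * ‖P m (x, l)‖ ^ 2) *
            (2 * M m (x, l) * ‖P m (x, l)‖ ^ 2)⁻¹) := by ring
          _ = _ := by rw [mul_inv_cancel₀ h4, mul_one]

end Weights

section Cauchy

lemma sub_ne_zero_of_im_ne_zero {z : ℂ} (hz : z.im ≠ 0) (t : ℝ) : z - t ≠ 0 := by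
  intro h
  apply hz
  simpa using congrArg Complex.im h

lemma abs_im_le_norm_sub (z : ℂ) (t : ℝ) : |z.im| ≤ ‖z - t‖ := by
  simpa using Complex.abs_im_le_norm (z - t)

lemma integrable_poisson {h : ℝ} (hh : 0 < h) (t : ℝ) :
    Integrable (fun x : ℝ => 2 * Complex.I / h * (((1 + ((x - t) / h) ^ 2)⁻¹ : ℝ) : ℂ)) := by
  refine Integrable.const_mul (Integrable.ofReal ?_) _
  exact (integrable_inv_one_add_sq.comp_div hh.ne').comp_sub_right t

lemma integral_poisson {h : ℝ} (hh : 0 < h) (t : ℝ) :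
    ∫ x : ℝ, 2 * Complex.I / h * (((1 + ((x - t) / h) ^ 2)⁻¹ : ℝ) : ℂ)
      = 2 * Real.pi * Complex.I := by
  rw [integral_const_mul, integral_complex_ofReal,
    integral_sub_right_eq_self (fun x : ℝ => (1 + (x / h) ^ 2)⁻¹) t,
    Measure.integral_comp_div (fun x : ℝ => (1 + x ^ 2)⁻¹) h, integral_univ_inv_one_add_sq,
    abs_of_pos hh]
  have : (h : ℂ) ≠ 0 := by exact_mod_cast hh.ne'
  push_cast [smul_eq_mul]
  field_simp

lemma norm_dslope_le {f : ℂ → ℂ} {t R : ℝ} {z : ℂ} (hR : 0 < R) (hz : R ≤ ‖z - t‖) :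
    ‖dslope f t z‖ ≤ (‖f z‖ + ‖f t‖) / R := by
  have hne : z ≠ t := by
    rintro rfl
    simp at hz
    linarith
  rw [dslope_of_ne _ hne, slope_def_field, norm_div]
  gcongr
  exact norm_sub_le _ _

lemma tendsto_integral_vertical {f : ℂ → ℂ} {h C : ℝ} (hh : 0 < h) (t : ℝ) {l : Filter ℝ}
    {a : ℝ → ℝ} (ha : Tendsto (fun A => |a A|) l atTop)
    (hC : ∀ x y : ℝ, |y| ≤ h → ‖f (x + y * Complex.I)‖ ≤ C) :
    Tendsto (fun A => ∫ y in (-h)..h, dslope f t (a A + y * Complex.I)) l (𝓝 0) := by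
  have h1 : Tendsto (fun A => (C + ‖f t‖) / (|a A| - |t|) * |h - -h|) l (𝓝 0) := by
    rw [← zero_mul |h - -h|]
    exact (Tendsto.const_div_atTop (tendsto_atTop_add_const_right _ _ ha) _).mul_const _
  refine squeeze_zero_norm' ?_ h1
  filter_upwards [ha.eventually_gt_atTop |t|] with A hA
  refine intervalIntegral.norm_integral_le_of_norm_le_const fun y hy => ?_
  rw [uIoc_of_le (by linarith)] at hy
  have h2 : |a A| - |t| ≤ ‖(a A + y * Complex.I - t : ℂ)‖ := by
    refine (abs_sub_abs_le_abs_sub _ _).trans ?_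
    simpa using Complex.abs_re_le_norm (a A + y * Complex.I - t : ℂ)
  refine (norm_dslope_le (by linarith) h2).trans ?_
  have : 0 ≤ |a A| - |t| := by linarith
  gcongr
  exact hC _ _ (abs_le.2 ⟨hy.1.le, hy.2⟩)

/-- The Cauchy integral formula for a horizontal strip. -/
lemma integral_strip_eq {f : ℂ → ℂ} (hf : Differentiable ℂ f) {h C : ℝ} (hh : 0 < h)
    (hC : ∀ x y : ℝ, |y| ≤ h → ‖f (x + y * Complex.I)‖ ≤ C * Real.exp (-x ^ 2)) (t : ℝ) :
    ∫ x : ℝ, (f (x - Complex.I * h) / (x - Complex.I * h - t)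
      - f (x + Complex.I * h) / (x + Complex.I * h - t)) = 2 * Real.pi * Complex.I * f t := by
  have hC0 : 0 ≤ C := by simpa using (norm_nonneg _).trans (hC 0 0 (by simpa using hh.le))
  have hm : ∀ x : ℝ, (x - Complex.I * h - t : ℂ) ≠ 0 := fun x =>
    sub_ne_zero_of_im_ne_zero (by simpa using hh.ne') t
  have hp : ∀ x : ℝ, (x + Complex.I * h - t : ℂ) ≠ 0 := fun x =>
    sub_ne_zero_of_im_ne_zero (by simpa using hh.ne') t
  set D : ℝ → ℂ := fun x => f (x - Complex.I * h) / (x - Complex.I * h - t)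
      - f (x + Complex.I * h) / (x + Complex.I * h - t) with hD
  have hfc := hf.continuous
  have hDint : Integrable D := by
    have hexp : Integrable fun x : ℝ => 2 * (C / h) * Real.exp (-x ^ 2) := by
      simpa using (integrable_exp_neg_mul_sq one_pos).const_mul (2 * (C / h))
    refine hexp.mono' (Continuous.aestronglyMeasurable ?_) (Eventually.of_forall fun x => ?_)
    · simp only [hD]
      exact (Continuous.div (by fun_prop) (by fun_prop) hm).sub
        (Continuous.div (by fun_prop) (by fun_prop) hp)
    · have e1 : ‖f (x - Complex.I * h) / (x - Complex.I * h - t)‖ ≤ C * Real.exp (-x ^ 2) / h := by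
        rw [norm_div]
        have := hC x (-h) (by rw [abs_neg, abs_of_pos hh])
        have h2 := abs_im_le_norm_sub (x - Complex.I * h) t
        simp only [Complex.sub_im, Complex.ofReal_im, Complex.mul_im, Complex.I_re, Complex.I_im,
          Complex.ofReal_re, zero_mul, one_mul, zero_add, zero_sub, abs_neg, abs_of_pos hh] at h2
        gcongr
        rwa [show (x - Complex.I * h : ℂ) = x + ((-h : ℝ) : ℂ) * Complex.I by push_cast; ring]
      have e2 : ‖f (x + Complex.I * h) / (x + Complex.I * h - t)‖ ≤ C * Real.exp (-x ^ 2) / h := by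
        rw [norm_div]
        have := hC x h (by rw [abs_of_pos hh])
        have h2 := abs_im_le_norm_sub (x + Complex.I * h) t
        simp only [Complex.add_im, Complex.ofReal_im, Complex.mul_im, Complex.I_re, Complex.I_im,
          Complex.ofReal_re, zero_mul, one_mul, zero_add, abs_of_pos hh] at h2
        gcongr
        rwa [mul_comm Complex.I]
      calc _ ≤ _ := norm_sub_le _ _
        _ ≤ _ := add_le_add e1 e2
        _ = _ := by ring
  set K : ℝ → ℂ := fun x => 2 * Complex.I / h * (((1 + ((x - t) / h) ^ 2)⁻¹ : ℝ) : ℂ) with hK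
  have hKint : Integrable K := integrable_poisson hh t
  have hdiff : ∀ x : ℝ, dslope f t (x - Complex.I * h) - dslope f t (x + Complex.I * h)
      = D x - f t * K x := by
    intro x
    rw [dslope_of_ne _ (sub_ne_zero.1 (hm x)), dslope_of_ne _ (sub_ne_zero.1 (hp x)),
      slope_def_field, slope_def_field]
    have hK' : K x = 1 / (x - Complex.I * h - t) - 1 / (x + Complex.I * h - t) := by
      have h0 : (h : ℂ) ≠ 0 := by exact_mod_cast hh.ne'
      have h1 : ((h : ℂ) ^ 2 + (x - t) ^ 2) ≠ 0 := by
        have := mul_ne_zero (hm x) (hp x)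
        intro h2
        apply this
        linear_combination h2 - h ^ 2 * Complex.I_sq
      simp only [hK]
      push_cast
      rw [div_sub_div _ _ (hm x) (hp x), show (x - Complex.I * h - t : ℂ) * (x + Complex.I * h - t)
        = h ^ 2 + (x - t) ^ 2 by linear_combination - h ^ 2 * Complex.I_sq]
      rw [show (1 + ((x - t) / h) ^ 2 : ℂ) = (h ^ 2 + (x - t) ^ 2) / h ^ 2 by field_simp]
      field_simp
      ring
    rw [hK']
    simp only [hD]
    ring
  have hdd : Differentiable ℂ (dslope f t) := by
    rw [← differentiableOn_univ] at hf ⊢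
    exact (Complex.differentiableOn_dslope univ_mem).2 hf
  have hrect : ∀ A : ℝ, (∫ x in (-A)..A, (D x - f t * K x)) =
      -(Complex.I * ∫ y in (-h)..h, dslope f t (A + y * Complex.I))
        + Complex.I * ∫ y in (-h)..h, dslope f t ((-A : ℝ) + y * Complex.I) := by
    intro A
    have h1 := Complex.integral_boundary_rect_eq_zero_of_differentiableOn (dslope f t)
      ⟨-A, -h⟩ ⟨A, h⟩ hdd.differentiableOn
    have hc := hdd.continuous
    rw [← intervalIntegral.integral_sub (Continuous.intervalIntegrable (by fun_prop) _ _)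
      (Continuous.intervalIntegrable (by fun_prop) _ _)] at h1
    have h2 : (∫ x in (-A)..A, (D x - f t * K x)) = ∫ x in (-A)..A,
        (dslope f t (x + ((-h : ℝ) : ℂ) * Complex.I) - dslope f t (x + h * Complex.I)) := by
      congr 1
      ext x
      rw [← hdiff]
      congr 2
      · push_cast; ring
      · ring
    rw [h2]
    simp only [smul_eq_mul] at h1
    linear_combination h1
  have hlim1 : Tendsto (fun A : ℝ => ∫ x in (-A)..A, (D x - f t * K x)) atTop (𝓝 0) := by
    simp only [hrect]
    have hC' : ∀ x y : ℝ, |y| ≤ h → ‖f (x + y * Complex.I)‖ ≤ C := fun x y hy =>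
      (hC x y hy).trans (mul_le_of_le_one_right hC0 (Real.exp_le_one_iff.2 (by nlinarith)))
    have t1 := tendsto_integral_vertical (f := f) hh t (a := fun A => A) tendsto_abs_atTop_atTop hC'
    have t2 := tendsto_integral_vertical (f := f) hh t (a := fun A => -A)
      (by simpa using tendsto_abs_atTop_atTop) hC'
    simpa using ((t1.const_mul Complex.I).neg).add (t2.const_mul Complex.I)
  have hlim2 := intervalIntegral_tendsto_integral (hDint.sub (hKint.const_mul (f t)))
    tendsto_neg_atTop_atBot tendsto_id
  have heq := tendsto_nhds_unique hlim1 hlim2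
  simp only [Pi.sub_apply] at heq
  rw [integral_sub hDint (hKint.const_mul _), integral_const_mul, integral_poisson hh t] at heq
  linear_combination - heq

end Cauchy

section Kernel

lemma hasTemperateGrowth_pi {E : Type*} [NormedAddCommGroup E] [NormedSpace ℝ E] {n : ℕ}
    {f : E → Fin n → ℝ} (hf : ∀ j, (fun x => f x j).HasTemperateGrowth) : f.HasTemperateGrowth := by
  have h : (fun x => ∑ j,
      ContinuousLinearMap.single ℝ (fun _ : Fin n => ℝ) j (f x j)).HasTemperateGrowth :=
    Function.HasTemperateGrowth.sum fun j _ =>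
      (ContinuousLinearMap.single ℝ (fun _ : Fin n => ℝ) j).hasTemperateGrowth.comp (hf j)
  refine (congrArg Function.HasTemperateGrowth (funext fun x => ?_)).mpr h
  exact (Finset.univ_sum_single (f x)).symm

/-- The horizontal contours: two for each height. -/
def signedHeight (i : Fin 17 × Bool) : ℝ := if i.2 then height i.1 else -height i.1

lemma signedHeight_sq (i : Fin 17 × Bool) : signedHeight i ^ 2 = height i.1 ^ 2 := by
  unfold signedHeight
  split_ifs <;> ring

lemma one_le_signedHeight_sq (i : Fin 17 × Bool) : 1 ≤ signedHeight i ^ 2 := by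
  rw [signedHeight_sq]
  exact one_le_pow₀ (one_le_height _)

lemma height_le (m : Fin 17) : height m ≤ 17 := by
  unfold height
  have : (m : ℝ) ≤ 16 := by exact_mod_cast Nat.lt_succ_iff.1 m.2
  linarith

lemma exists_signed_contour_weights :
    ∃ (w : Fin 17 → (Fin 4 → ℝ) → ℝ) (G : Fin 17 × Bool → ℝ × (Fin 4 → ℝ) → ℂ),
      (∀ i, (G i).HasTemperateGrowth) ∧ (∀ l, ∑ m, w m l = 1) ∧
      ∀ i (x : ℝ) l,
        quartic l ((x : ℂ) + Complex.I * signedHeight i) * G i (x, l) = w i.1 l := by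
  obtain ⟨w, G, hG, hw, h⟩ := exists_contour_weights
  refine ⟨w, fun i p => if i.2 then G i.1 p else (starRingEnd ℂ) (G i.1 p), ?_, hw, ?_⟩
  · rintro ⟨m, b⟩
    cases b
    · simpa using hasTemperateGrowth_conj (hG m)
    · simpa using hG m
  · rintro ⟨m, b⟩ x l
    cases b
    · have := congrArg (starRingEnd ℂ) (h m x l)
      rw [map_mul, conj_quartic] at this
      simpa [signedHeight] using this
    · simpa [signedHeight] using h m x l

/-- The point over `x` on the contour of height `η`, at frequency `k`. -/
noncomputable def node (η : ℝ) (q : ℝ × ℝ) : ℂ :=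
  q.2 + Complex.I * (η * cutoffInv (1 + q.1 ^ 2) : ℝ)

/-- The function `1 / (z - t)` on the contour of height `η`. -/
noncomputable def resolvent (η t : ℝ) (q : ℝ × ℝ) : ℂ :=
  (1 + q.1 ^ 2 : ℝ) * (((1 + q.1 ^ 2) * (q.2 - t) : ℝ) + -(Complex.I * η)) *
    (cutoffInv (((1 + q.1 ^ 2) * (q.2 - t)) ^ 2 + η ^ 2) : ℝ)

/-- The coefficients of the quartic whose roots are dilated by `1 + k ^ 2`. -/
def dilate (l : Fin 4 → ℝ) (k : ℝ) (j : Fin 4) : ℝ := (1 + k ^ 2) ^ (4 - (j : ℕ)) * l j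

/-- The coefficients in `t` of `(P(z) - P(t)) / (z - t)`. -/
def cofactor (l : Fin 4 → ℝ) (z : ℂ) : Fin 4 → ℂ :=
  ![z ^ 3 + l 3 * z ^ 2 + l 2 * z + l 1, z ^ 2 + l 3 * z + l 2, z + l 3, 1]

lemma cutoffInv_one_add_sq (k : ℝ) : cutoffInv (1 + k ^ 2) = (1 + k ^ 2)⁻¹ :=
  cutoffInv_of_one_le (by nlinarith [sq_nonneg k])

lemma mul_node (η : ℝ) (q : ℝ × ℝ) :
    ((1 + q.1 ^ 2 : ℝ) : ℂ) * node η q = ((1 + q.1 ^ 2) * q.2 : ℝ) + Complex.I * η := by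
  have h : ((1 + q.1 ^ 2 : ℝ) : ℂ) * ((1 + q.1 ^ 2 : ℝ) : ℂ)⁻¹ = 1 :=
    mul_inv_cancel₀ (by exact_mod_cast (by positivity : (1 + q.1 ^ 2 : ℝ) ≠ 0))
  rw [node, cutoffInv_one_add_sq]
  rw [Complex.ofReal_mul η, Complex.ofReal_inv, Complex.ofReal_mul]
  linear_combination Complex.I * η * h

lemma node_sub_mul_resolvent {η : ℝ} (hη : 1 ≤ η ^ 2) (t : ℝ) (q : ℝ × ℝ) :
    (node η q - t) * resolvent η t q = 1 := by
  set a : ℝ := (1 + q.1 ^ 2) * (q.2 - t) with ha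
  have h1 : ((1 + q.1 ^ 2 : ℝ) : ℂ) * (node η q - t) = a + Complex.I * η := by
    rw [mul_sub, mul_node, ha]
    push_cast
    ring
  have h2 : ((a ^ 2 + η ^ 2 : ℝ) : ℂ) * ((a ^ 2 + η ^ 2 : ℝ) : ℂ)⁻¹ = 1 :=
    mul_inv_cancel₀ (by exact_mod_cast (by nlinarith [sq_nonneg a] : (a ^ 2 + η ^ 2 : ℝ) ≠ 0))
  rw [resolvent, ← ha, cutoffInv_of_one_le (by nlinarith [sq_nonneg a])]
  calc _ = (((1 + q.1 ^ 2 : ℝ) : ℂ) * (node η q - t)) * (a + -(Complex.I * η)) *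
        (((a ^ 2 + η ^ 2)⁻¹ : ℝ) : ℂ) := by ring
    _ = ((a ^ 2 + η ^ 2 : ℝ) : ℂ) * ((a ^ 2 + η ^ 2 : ℝ) : ℂ)⁻¹ := by
      rw [h1, Complex.ofReal_inv]
      push_cast
      linear_combination - (η : ℂ) ^ 2 * ((a : ℂ) ^ 2 + (η : ℂ) ^ 2)⁻¹ * Complex.I_sq
    _ = 1 := h2

lemma resolvent_eq {η : ℝ} (hη : 1 ≤ η ^ 2) (t : ℝ) (q : ℝ × ℝ) :
    resolvent η t q = (node η q - t)⁻¹ :=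
  eq_inv_of_mul_eq_one_right (node_sub_mul_resolvent hη t q)

lemma quartic_dilate (l : Fin 4 → ℝ) (η : ℝ) (q : ℝ × ℝ) :
    quartic (dilate l q.1) (((1 + q.1 ^ 2) * q.2 : ℝ) + Complex.I * η : ℂ)
      = ((1 + q.1 ^ 2 : ℝ) : ℂ) ^ 4 * quartic l (node η q) := by
  rw [← mul_node]
  simp [quartic, dilate]
  ring

lemma quartic_sub_quartic (l : Fin 4 → ℝ) (z : ℂ) (t : ℝ) :
    quartic l z - ((quartic l t : ℝ) : ℂ) =
      (z - t) * ∑ j : Fin 4, cofactor l z j * (t : ℂ) ^ (j : ℕ) := by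
  simp [quartic, cofactor, Fin.sum_univ_four]
  ring

lemma hasTemperateGrowth_node (η : ℝ) : (node η).HasTemperateGrowth := by
  unfold node
  have h : (fun q : ℝ × ℝ => η * cutoffInv (1 + q.1 ^ 2)).HasTemperateGrowth :=
    (Function.HasTemperateGrowth.const η).mul (hasTemperateGrowth_cutoffInv_comp (by fun_prop))
  have h2 : (fun q : ℝ × ℝ => (q.2 : ℂ)).HasTemperateGrowth := by fun_prop
  exact h2.add ((Function.HasTemperateGrowth.const Complex.I).mul (hasTemperateGrowth_ofReal h))

lemma hasTemperateGrowth_resolvent (η : ℝ) :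
    (fun p : ℝ × (ℝ × ℝ) => resolvent η p.1 p.2).HasTemperateGrowth := by
  unfold resolvent
  have h1 : (fun p : ℝ × (ℝ × ℝ) => 1 + p.2.1 ^ 2).HasTemperateGrowth := by fun_prop
  have h2 : (fun p : ℝ × (ℝ × ℝ) => (1 + p.2.1 ^ 2) * (p.2.2 - p.1)).HasTemperateGrowth :=
    h1.mul (by fun_prop)
  have h3 := hasTemperateGrowth_cutoffInv_comp
    ((h2.pow 2).add (Function.HasTemperateGrowth.const (η ^ 2)))
  exact ((hasTemperateGrowth_ofReal h1).mul ((hasTemperateGrowth_ofReal h2).add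
    (Function.HasTemperateGrowth.const (-(Complex.I * η))))).mul (hasTemperateGrowth_ofReal h3)

lemma hasTemperateGrowth_dilate :
    (fun p : (Fin 4 → ℝ) × ℝ => dilate p.1 p.2).HasTemperateGrowth := by
  refine hasTemperateGrowth_pi fun j => ?_
  have h1 : (fun p : (Fin 4 → ℝ) × ℝ => 1 + p.2 ^ 2).HasTemperateGrowth := by fun_prop
  have h2 : (fun p : (Fin 4 → ℝ) × ℝ => p.1 j).HasTemperateGrowth :=
    (hasTemperateGrowth_apply j).comp (hasTemperateGrowth_fst (by fun_prop))
  exact (h1.pow _).mul h2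

lemma hasTemperateGrowth_cofactor (η : ℝ) (j : Fin 4) :
    (fun p : (Fin 4 → ℝ) × (ℝ × ℝ) => cofactor p.1 (node η p.2) j).HasTemperateGrowth := by
  have hz : (fun p : (Fin 4 → ℝ) × (ℝ × ℝ) => node η p.2).HasTemperateGrowth :=
    (hasTemperateGrowth_node η).comp (hasTemperateGrowth_snd (by fun_prop))
  have hl : ∀ j, (fun p : (Fin 4 → ℝ) × (ℝ × ℝ) => (p.1 j : ℂ)).HasTemperateGrowth := fun j =>
    hasTemperateGrowth_ofReal ((hasTemperateGrowth_apply j).comp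
      (hasTemperateGrowth_fst (by fun_prop)))
  unfold cofactor
  fin_cases j
  · exact (((hz.pow 3).add ((hl 3).mul (hz.pow 2))).add ((hl 2).mul hz)).add (hl 1)
  · exact ((hz.pow 2).add ((hl 3).mul hz)).add (hl 2)
  · exact hz.add (hl 3)
  · exact Function.HasTemperateGrowth.const 1

end Kernel

section Division

/-- Plane waves with a Gaussian factor. -/
noncomputable def wave (k : ℝ) (z : ℂ) : ℂ :=
  Complex.exp (2 * Real.pi * k * z * Complex.I - z ^ 2)

lemma differentiable_wave (k : ℝ) : Differentiable ℂ (wave k) := by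
  unfold wave
  fun_prop

lemma norm_wave_le {k x y : ℝ} (hy : |y| ≤ 17 * cutoffInv (1 + k ^ 2)) :
    ‖wave k (x + y * Complex.I)‖ ≤ Real.exp (34 * Real.pi + 289) * Real.exp (-x ^ 2) := by
  rw [wave, Complex.norm_exp, ← Real.exp_add]
  rw [cutoffInv_one_add_sq] at hy
  have hk : 0 < 1 + k ^ 2 := by positivity
  have h1 : |y| * (1 + k ^ 2) ≤ 17 := by
    calc |y| * (1 + k ^ 2) ≤ 17 * (1 + k ^ 2)⁻¹ * (1 + k ^ 2) := by gcongr
      _ = 17 := by field_simp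
  have h2 : |y| ≤ 17 := by nlinarith [abs_nonneg y, sq_nonneg k]
  have h3 : -(k * y) ≤ 17 := by
    have h4 : |k| ≤ 1 + k ^ 2 := by nlinarith [sq_nonneg (|k| - 1), sq_abs k, abs_nonneg k]
    calc -(k * y) ≤ |k * y| := neg_le_abs _
      _ = |y| * |k| := by rw [abs_mul, mul_comm]
      _ ≤ |y| * (1 + k ^ 2) := by gcongr
      _ ≤ 17 := h1
  have h5 : y ^ 2 ≤ 289 := by nlinarith [abs_nonneg y, sq_abs y]
  have h6 : (2 * Real.pi * k * (x + y * Complex.I) * Complex.I - (x + y * Complex.I) ^ 2 : ℂ).re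
      = 2 * Real.pi * (-(k * y)) - x ^ 2 + y ^ 2 := by
    simp [pow_two]
    ring
  rw [h6, Real.exp_le_exp]
  have h7 := mul_le_mul_of_nonneg_left h3 (by positivity : 0 ≤ 2 * Real.pi)
  linarith

lemma node_eq (η : ℝ) (q : ℝ × ℝ) :
    node η q = q.2 + ((η * cutoffInv (1 + q.1 ^ 2) : ℝ) : ℂ) * Complex.I := by
  rw [node, mul_comm Complex.I]

lemma abs_signedHeight_le (i : Fin 17 × Bool) : |signedHeight i| ≤ 17 := by
  have h := height_le i.1
  have h1 := one_le_height i.1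
  unfold signedHeight
  split_ifs
  · rwa [abs_of_nonneg (by linarith)]
  · rwa [abs_neg, abs_of_nonneg (by linarith)]

lemma norm_wave_node_le (i : Fin 17 × Bool) (q : ℝ × ℝ) :
    ‖wave q.1 (node (signedHeight i) q)‖
      ≤ Real.exp (34 * Real.pi + 289) * Real.exp (-q.2 ^ 2) := by
  rw [node_eq]
  refine norm_wave_le ?_
  rw [abs_mul, abs_of_nonneg (cutoffInv_nonneg _)]
  exact mul_le_mul_of_nonneg_right (abs_signedHeight_le i) (cutoffInv_nonneg _)

lemma integrable_one_add_norm_pow_mul {f : ℝ → ℝ} (hf : ∀ N : ℕ, Integrable fun x => |x| ^ N * f x)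
    (N : ℕ) : Integrable fun x => (1 + |x|) ^ N * f x := by
  have h : (fun x => (1 + |x|) ^ N * f x)
      = fun x => ∑ j ∈ Finset.range (N + 1), (N.choose j : ℝ) * (|x| ^ j * f x) := by
    ext x
    rw [add_comm, add_pow, Finset.sum_mul]
    exact Finset.sum_congr rfl fun j _ => by ring
  rw [h]
  exact integrable_finsetSum _ fun j _ => (hf j).const_mul _

lemma integrable_abs_pow_mul_exp_neg_sq (N : ℕ) :
    Integrable fun x : ℝ => |x| ^ N * Real.exp (-x ^ 2) := by
  have h := (integrable_rpow_mul_exp_neg_mul_sq one_pos (s := N)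
    (by linarith [Nat.cast_nonneg (α := ℝ) N])).norm
  refine h.congr (Eventually.of_forall fun x => ?_)
  simp

lemma integrable_weight (i : Fin 17 × Bool) {g : ℝ → ℂ} (hg : Continuous g)
    (hgi : ∀ N : ℕ, Integrable fun k => |k| ^ N * ‖g k‖) (N : ℕ) :
    Integrable (fun q : ℝ × ℝ => (1 + ‖q‖) ^ N * ‖g q.1 * wave q.1 (node (signedHeight i) q)‖) := by
  have h := ((integrable_one_add_norm_pow_mul hgi N).mul_prod
    (integrable_one_add_norm_pow_mul integrable_abs_pow_mul_exp_neg_sq N)).const_mul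
      (Real.exp (34 * Real.pi + 289))
  have hn := (hasTemperateGrowth_node (signedHeight i)).1.continuous
  refine h.mono' (Continuous.aestronglyMeasurable ?_) (Eventually.of_forall fun q => ?_)
  · unfold wave
    fun_prop
  · have h1 : 1 + ‖q‖ ≤ (1 + |q.1|) * (1 + |q.2|) := by
      have h1 := abs_nonneg q.1
      have h2 := abs_nonneg q.2
      rw [Prod.norm_def, Real.norm_eq_abs, Real.norm_eq_abs]
      rcases max_cases |q.1| |q.2| with ⟨h, -⟩ | ⟨h, -⟩ <;> rw [h] <;> nlinarith
    rw [Real.norm_of_nonneg (by positivity), norm_mul]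
    calc _ ≤ ((1 + |q.1|) * (1 + |q.2|)) ^ N *
        (‖g q.1‖ * (Real.exp (34 * Real.pi + 289) * Real.exp (-q.2 ^ 2))) := by
          gcongr
          exact norm_wave_node_le i q
      _ = _ := by rw [mul_pow]; ring

lemma integral_wave (m : Fin 17) (k t : ℝ) :
    ∫ x : ℝ, (wave k (node (signedHeight (m, false)) (k, x)) *
        resolvent (signedHeight (m, false)) t (k, x)
      - wave k (node (signedHeight (m, true)) (k, x)) *
        resolvent (signedHeight (m, true)) t (k, x)) = 2 * Real.pi * Complex.I * wave k t := by
  have hpos : 0 < height m * cutoffInv (1 + k ^ 2) := by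
    rw [cutoffInv_one_add_sq]
    have := one_le_height m
    positivity
  rw [← integral_strip_eq (differentiable_wave k) hpos (t := t)
    (C := Real.exp (34 * Real.pi + 289)) fun x y hy => norm_wave_le (hy.trans
      (mul_le_mul_of_nonneg_right (height_le m) (cutoffInv_nonneg _)))]
  congr 1
  ext x
  rw [resolvent_eq (one_le_signedHeight_sq _), resolvent_eq (one_le_signedHeight_sq _),
    ← div_eq_mul_inv, ← div_eq_mul_inv]
  simp [signedHeight, node, sub_eq_add_neg]

lemma exists_wave_division {g : ℝ → ℂ} (hg : Continuous g)
    (hgi : ∀ N : ℕ, Integrable fun k => |k| ^ N * ‖g k‖) :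
    ∃ (Q : ℝ × (Fin 4 → ℝ) → ℂ) (r : Fin 4 → (Fin 4 → ℝ) → ℂ),
      ContDiff ℝ ∞ Q ∧ (∀ j, ContDiff ℝ ∞ (r j)) ∧ ∀ (t : ℝ) (l : Fin 4 → ℝ),
        ∫ k, g k * wave k t
          = ((quartic l t : ℝ) : ℂ) * Q (t, l) + ∑ j, r j l * (t : ℂ) ^ (j : ℕ) := by
  obtain ⟨w, G, hG, hw, hGw⟩ := exists_signed_contour_weights
  let T : Fin 17 × Bool → (Fin 4 → ℝ) × (ℝ × ℝ) → ℂ := fun i p =>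
    ((1 + p.2.1 ^ 2 : ℝ) : ℂ) ^ 4 * G i ((1 + p.2.1 ^ 2) * p.2.2, dilate p.1 p.2.1)
  have hT : ∀ i l q, quartic l (node (signedHeight i) q) * T i (l, q)
      = w i.1 (dilate l q.1) := by
    intro i l q
    rw [← hGw i ((1 + q.1 ^ 2) * q.2), quartic_dilate]
    simp only [T]
    ring
  have hTg : ∀ i, (T i).HasTemperateGrowth := by
    intro i
    have h1 : (fun p : (Fin 4 → ℝ) × (ℝ × ℝ) => 1 + p.2.1 ^ 2).HasTemperateGrowth := by fun_prop
    have h2 : (fun p : (Fin 4 → ℝ) × (ℝ × ℝ) => p.2.2).HasTemperateGrowth := by fun_prop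
    have h3 : (fun p : (Fin 4 → ℝ) × (ℝ × ℝ) => (p.1, p.2.1)).HasTemperateGrowth := by fun_prop
    exact ((hasTemperateGrowth_ofReal h1).pow 4).mul
      ((hG i).comp (hasTemperateGrowth_prodMk (h1.mul h2) (hasTemperateGrowth_dilate.comp h3)))
  let A : Fin 17 × Bool → ℝ × ℝ → ℂ := fun i q => g q.1 * wave q.1 (node (signedHeight i) q)
  have hA : ∀ i, Continuous (A i) := by
    intro i
    have hn := (hasTemperateGrowth_node (signedHeight i)).1.continuous
    simp only [A, wave]
    fun_prop
  have hQ := fun i => contDiff_integral_of_hasTemperateGrowth (hA i).aestronglyMeasurable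
    (integrable_weight i hg hgi)
    (Φ := fun p : (ℝ × (Fin 4 → ℝ)) × (ℝ × ℝ) =>
      T i (p.1.2, p.2) * resolvent (signedHeight i) p.1.1 p.2)
    (((hTg i).comp (by fun_prop)).mul ((hasTemperateGrowth_resolvent _).comp
      (f := fun p : (ℝ × (Fin 4 → ℝ)) × (ℝ × ℝ) => (p.1.1, p.2)) (by fun_prop)))
  have hr := fun i j => contDiff_integral_of_hasTemperateGrowth (hA i).aestronglyMeasurable
    (integrable_weight i hg hgi)
    (Φ := fun p : (Fin 4 → ℝ) × (ℝ × ℝ) => T i p * cofactor p.1 (node (signedHeight i) p.2) j)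
    ((hTg i).mul (hasTemperateGrowth_cofactor _ j))
  let s : Fin 17 × Bool → ℂ := fun i => if i.2 then -1 else 1
  let c : ℂ := 2 * Real.pi * Complex.I
  have hc : c ≠ 0 := by simp [c, Real.pi_ne_zero]
  refine ⟨fun y => c⁻¹ * ∑ i, s i * ∫ q, A i q *
      (T i (y.2, q) * resolvent (signedHeight i) y.1 q),
    fun j l => c⁻¹ * ∑ i, s i * ∫ q, A i q * (T i (l, q) * cofactor l (node (signedHeight i) q) j),
    contDiff_const.mul (ContDiff.sum fun i _ => contDiff_const.mul (hQ i).2),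
    fun j => contDiff_const.mul (ContDiff.sum fun i _ => contDiff_const.mul (hr i j).2),
    fun t l => ?_⟩
  let N : Fin 17 × Bool → ℝ × ℝ → ℂ := fun i q =>
    A i q * (w i.1 (dilate l q.1) * resolvent (signedHeight i) t q)
  have hN : ∀ i q, N i q = ((quartic l t : ℝ) : ℂ) *
      (A i q * (T i (l, q) * resolvent (signedHeight i) t q)) +
        ∑ j : Fin 4, (t : ℂ) ^ (j : ℕ) *
          (A i q * (T i (l, q) * cofactor l (node (signedHeight i) q) j)) := by
    intro i q
    have h1 := quartic_sub_quartic l (node (signedHeight i) q) t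
    have h2 := node_sub_mul_resolvent (one_le_signedHeight_sq i) t q
    have h3 : ∑ j : Fin 4, (t : ℂ) ^ (j : ℕ) *
          (A i q * (T i (l, q) * cofactor l (node (signedHeight i) q) j))
        = A i q * T i (l, q) *
          ∑ j : Fin 4, cofactor l (node (signedHeight i) q) j * (t : ℂ) ^ (j : ℕ) := by
      rw [Finset.mul_sum]
      exact Finset.sum_congr rfl fun j _ => by ring
    simp only [N]
    rw [h3, ← hT]
    linear_combination (A i q * T i (l, q) * resolvent (signedHeight i) t q) * h1 +
      (A i q * T i (l, q) *
          ∑ j : Fin 4, cofactor l (node (signedHeight i) q) j * (t : ℂ) ^ (j : ℕ)) * h2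
  have hi1 := fun i => ((hQ i).1 (t, l)).const_mul ((quartic l t : ℝ) : ℂ)
  have hi2 := fun i (j : Fin 4) => ((hr i j).1 l).const_mul ((t : ℂ) ^ (j : ℕ))
  have hNi : ∀ i, Integrable (N i) := by
    intro i
    rw [funext (hN i)]
    exact (hi1 i).add (integrable_finsetSum _ fun j _ => hi2 i j)
  have hNint : ∀ i, ∫ q, N i q = ((quartic l t : ℝ) : ℂ) *
      (∫ q, A i q * (T i (l, q) * resolvent (signedHeight i) t q)) +
        ∑ j : Fin 4, (t : ℂ) ^ (j : ℕ) *
          ∫ q, A i q * (T i (l, q) * cofactor l (node (signedHeight i) q) j) := by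
    intro i
    rw [funext (hN i), integral_add (hi1 i) (integrable_finsetSum _ fun j _ => hi2 i j),
      integral_finsetSum _ fun j _ => hi2 i j, integral_const_mul]
    simp only [integral_const_mul]
  have hae : ∀ᵐ k : ℝ, ∀ i, Integrable fun x => N i (k, x) := by
    rw [ae_all_iff]
    intro i
    have := hNi i
    rw [Measure.volume_eq_prod] at this
    exact this.prod_right_ae
  have hsum : ∑ i, s i * ∫ q, N i q = c * ∫ k, g k * wave k t := by
    simp only [← integral_const_mul]
    rw [← integral_finsetSum _ fun i _ => (hNi i).const_mul _, Measure.volume_eq_prod,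
      integral_prod]
    · refine integral_congr_ae ?_
      filter_upwards [hae] with k hk
      have h1 : ∀ x, ∑ i, s i * N i (k, x) = ∑ m : Fin 17, (g k * w m (dilate l k)) *
          (wave k (node (signedHeight (m, false)) (k, x)) *
            resolvent (signedHeight (m, false)) t (k, x)
          - wave k (node (signedHeight (m, true)) (k, x)) *
            resolvent (signedHeight (m, true)) t (k, x)) := by
        intro x
        rw [Fintype.sum_prod_type]
        refine Finset.sum_congr rfl fun m _ => ?_
        rw [Fintype.sum_bool]
        simp only [s, N, A, if_true, Bool.false_eq_true, if_false]
        ring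
      simp only [h1]
      rw [integral_finsetSum]
      · simp only [integral_const_mul, integral_wave]
        rw [← Finset.sum_mul, ← Finset.mul_sum, ← Complex.ofReal_sum, hw]
        simp only [c]
        push_cast
        ring
      · intro m _
        refine ((hk (m, false)).sub (hk (m, true))).congr (Eventually.of_forall fun x => ?_)
        simp only [N, A, Pi.sub_apply]
        ring
    · rw [← Measure.volume_eq_prod]
      exact integrable_finsetSum _ fun i _ => (hNi i).const_mul _
  have hcomm : ∀ (a : Fin 17 × Bool → ℂ) (b : Fin 17 × Bool → Fin 4 → ℂ) (P : ℂ),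
      ∑ i, s i * (P * a i + ∑ j : Fin 4, (t : ℂ) ^ (j : ℕ) * b i j) =
        c * (P * (c⁻¹ * ∑ i, s i * a i)
          + ∑ j : Fin 4, (c⁻¹ * ∑ i, s i * b i j) * (t : ℂ) ^ (j : ℕ)) := by
    intro a b P
    rw [mul_add, mul_left_comm c, mul_inv_cancel_left₀ hc]
    simp only [mul_add, Finset.sum_add_distrib, Finset.mul_sum, Finset.sum_mul]
    rw [Finset.sum_comm (s := (Finset.univ : Finset (Fin 17 × Bool)))
      (t := (Finset.univ : Finset (Fin 4)))]
    congr 1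
    · exact Finset.sum_congr rfl fun i _ => by ring
    · refine Finset.sum_congr rfl fun j _ => Finset.sum_congr rfl fun i _ => ?_
      rw [mul_assoc c⁻¹, mul_inv_cancel_left₀ hc]
      ring
  rw [← mul_right_inj' hc, ← hsum]
  simp only [hNint]
  exact hcomm _ _ _

open scoped FourierTransform in
/-- The Malgrange division theorem for a function of one variable and the generic quartic. -/
theorem exists_division {F : ℝ → ℝ} (hF : ContDiff ℝ ∞ F) :
    ∃ (Q : ℝ × (Fin 4 → ℝ) → ℝ) (r : Fin 4 → (Fin 4 → ℝ) → ℝ),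
      ContDiff ℝ ∞ Q ∧ (∀ j, ContDiff ℝ ∞ (r j)) ∧ ∀ (t : ℝ) (l : Fin 4 → ℝ), |t| ≤ 1 →
        F t = quartic l t * Q (t, l) + ∑ j, r j l * t ^ (j : ℕ) := by
  let b : ContDiffBump (0 : ℝ) := ⟨1, 2, one_pos, one_lt_two⟩
  let G₀ : ℝ → ℂ := fun t => ((b t * (F t * Real.exp (t ^ 2)) : ℝ) : ℂ)
  have hG₀ : ContDiff ℝ ∞ G₀ := by
    have hb : ContDiff ℝ ∞ b := b.contDiff
    have h : ContDiff ℝ ∞ fun t : ℝ => b t * (F t * Real.exp (t ^ 2)) := by fun_prop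
    exact Complex.ofRealCLM.contDiff.comp h
  have hG₀c : HasCompactSupport G₀ :=
    (b.hasCompactSupport.mul_right (f' := fun t => F t * Real.exp (t ^ 2))).comp_left
      (g := Complex.ofReal) Complex.ofReal_zero
  let G : SchwartzMap ℝ ℂ := hG₀c.toSchwartzMap hG₀
  let g : SchwartzMap ℝ ℂ := 𝓕 G
  obtain ⟨Q, r, hQ, hr, h⟩ := exists_wave_division g.continuous
    fun N => by simpa using g.integrable_pow_mul volume N
  refine ⟨fun y => (Q y).re, fun j l => (r j l).re, Complex.reCLM.contDiff.comp hQ,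
    fun j => Complex.reCLM.contDiff.comp (hr j), fun t l ht => ?_⟩
  have h1 : ∫ k, g k * wave k t = F t := by
    have h2 : (𝓕⁻ g) t = G t := by simp [g]
    rw [SchwartzMap.fourierInv_coe, Real.fourierInv_eq'] at h2
    have h3 : G t = ((F t * Real.exp (t ^ 2) : ℝ) : ℂ) := by
      change ((b t * (F t * Real.exp (t ^ 2)) : ℝ) : ℂ) = _
      rw [b.one_of_mem_closedBall (by simpa [b] using ht), one_mul]
    have h4 : ∀ k : ℝ, g k * wave k t = Complex.exp (-(t : ℂ) ^ 2) *
        (Complex.exp (((2 * Real.pi * inner ℝ k t : ℝ) : ℂ) * Complex.I) • g k) := by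
      intro k
      rw [smul_eq_mul, ← mul_assoc, ← Complex.exp_add, wave, mul_comm]
      congr 2
      simp
      ring
    simp only [h4]
    rw [integral_const_mul, h2, h3]
    push_cast
    rw [mul_left_comm, ← Complex.exp_add]
    simp
  have h5 := congrArg Complex.re ((h t l).symm.trans h1)
  rw [Complex.ofReal_re] at h5
  rw [← h5, Complex.add_re, Complex.re_ofReal_mul, Complex.re_sum]
  congr 1
  refine Finset.sum_congr rfl fun j _ => ?_
  rw [← Complex.ofReal_pow, Complex.re_mul_ofReal]

end Division

section Inverse

variable {E F : Type*} [NormedAddCommGroup E] [NormedSpace ℝ E] [FiniteDimensional ℝ E]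
  [NormedAddCommGroup F] [NormedSpace ℝ F] [FiniteDimensional ℝ F]

/-- The smooth inverse function theorem, with an inverse that is smooth on an open set. -/
lemma exists_smooth_leftInverse {f : E → E} {O : Set E} (hO : IsOpen O)
    (hf : ContDiffOn ℝ ∞ f O) {x : E} (hx : x ∈ O) (hinj : Injective (fderiv ℝ f x)) :
    ∃ (U : Set E) (g : E → E), IsOpen U ∧ x ∈ U ∧ U ⊆ O ∧ (∀ z ∈ U, g (f z) = z) ∧
      IsOpen (f '' U) ∧ ContDiffOn ℝ ∞ g (f '' U) := by
  have hcd : ∀ z ∈ O, ContDiffAt ℝ ∞ f z := fun z hz => hf.contDiffAt (hO.mem_nhds hz)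
  let e : E ≃L[ℝ] E :=
    (LinearEquiv.ofInjectiveEndo (fderiv ℝ f x : E →ₗ[ℝ] E) hinj).toContinuousLinearEquiv
  have he : (e : E →L[ℝ] E) = fderiv ℝ f x := by
    ext v
    rfl
  have hfe : HasStrictFDerivAt f (e : E →L[ℝ] E) x := by
    rw [he]
    exact (hcd x hx).hasStrictFDerivAt (by simp)
  let Φ := hfe.toOpenPartialHomeomorph f
  have hopen : IsOpen (O ∩ fderiv ℝ f ⁻¹' range ((↑) : (E ≃L[ℝ] E) → E →L[ℝ] E)) :=
    (hf.continuousOn_fderiv_of_isOpen hO (by simp)).isOpen_inter_preimage hO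
      (ContinuousLinearEquiv.isOpen)
  refine ⟨Φ.source ∩ (O ∩ fderiv ℝ f ⁻¹' range ((↑) : (E ≃L[ℝ] E) → E →L[ℝ] E)), Φ.symm,
    Φ.open_source.inter hopen, ⟨hfe.mem_toOpenPartialHomeomorph_source, hx, ⟨e, he⟩⟩,
    fun z hz => hz.2.1, fun z hz => Φ.left_inv hz.1,
    Φ.isOpen_image_of_subset_source (Φ.open_source.inter hopen) inter_subset_left, ?_⟩
  rintro _ ⟨z, ⟨hz, hzO, ⟨e', he'⟩⟩, rfl⟩
  refine ContDiffAt.contDiffWithinAt ?_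
  have hz' : Φ.symm (f z) = z := Φ.left_inv hz
  refine Φ.contDiffAt_symm (f₀' := e') (Φ.map_source hz) ?_ ?_
  · rw [hz', he']
    exact ((hcd z hzO).differentiableAt (by simp)).hasFDerivAt
  · rw [hz']
    exact hcd z hzO

lemma locallyDiffeomorphic_of_injective_fderiv {f g : E → F} {σ : E → E} {τ : F → F} {p q : E}
    {V : Set E} {W : Set F} (hV : IsOpen V) (hp : p ∈ V) (hW : IsOpen W) (hfp : f p ∈ W)
    (hf : ContinuousOn f V) (hσ : ContDiffOn ℝ ∞ σ V) (hτ : ContDiffOn ℝ ∞ τ W)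
    (hσi : Injective (fderiv ℝ σ p)) (hτi : Injective (fderiv ℝ τ (f p))) (hq : σ p = q)
    (h : ∀ x ∈ V, τ (f x) = g (σ x)) : LocallyDiffeomorphic f p g q := by
  obtain ⟨U₁, σi, hU₁, hpU₁, hU₁V, hl₁, -, hs₁⟩ := exists_smooth_leftInverse hV hσ hp hσi
  obtain ⟨W₁, τi, hW₁, hpW₁, hW₁W, hl₂, -, hs₂⟩ := exists_smooth_leftInverse hW hτ hfp hτi
  have hU : U₁ ∩ (V ∩ f ⁻¹' W₁) ⊆ U₁ := inter_subset_left
  exact ⟨σ, σi, τ, τi, U₁ ∩ (V ∩ f ⁻¹' W₁), W₁,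
    hU₁.inter (hf.isOpen_inter_preimage hV hW₁), ⟨hpU₁, hp, hpW₁⟩, hW₁, hpW₁,
    hσ.mono (hU.trans hU₁V), hτ.mono hW₁W, fun x hx => hl₁ x (hU hx), hl₂,
    hs₁.mono (image_mono hU), hs₂, hq, by rintro _ ⟨x, hx, rfl⟩; exact hx.2.2,
    fun x hx => h x hx.2.1⟩

end Inverse

section Unfolding

open Asymptotics

lemma eq_zero_of_sum_mul_pow_isLittleO {n : ℕ} {a : Fin (n + 1) → ℝ}
    (h : (fun t : ℝ => ∑ j, a j * t ^ (j : ℕ)) =o[𝓝[≠] 0] fun t => t ^ n) : a = 0 := by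
  induction n with
  | zero =>
    ext j
    obtain rfl : j = 0 := Fin.fin_one_eq_zero j
    simpa [isLittleO_const_const_iff] using h
  | succ n ih =>
    have h0 : a 0 = 0 := by
      have h1 : Tendsto (fun t : ℝ => ∑ j, a j * t ^ (j : ℕ)) (𝓝[≠] 0) (𝓝 0) :=
        h.trans_tendsto (by
          have : Tendsto (fun t : ℝ => t ^ (n + 1)) (𝓝 0) (𝓝 (0 ^ (n + 1))) :=
            (continuous_pow (n + 1)).tendsto 0
          rw [zero_pow (Nat.succ_ne_zero n)] at this
          exact this.mono_left nhdsWithin_le_nhds)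
      have h2 : Tendsto (fun t : ℝ => ∑ j, a j * t ^ (j : ℕ)) (𝓝[≠] 0)
          (𝓝 (∑ j, a j * 0 ^ (j : ℕ))) :=
        (Continuous.tendsto (by fun_prop) 0).mono_left nhdsWithin_le_nhds
      have h3 := tendsto_nhds_unique h2 h1
      simpa [Fin.sum_univ_succ] using h3
    have h1 : (fun j : Fin (n + 1) => a j.succ) = 0 := by
      refine ih ?_
      have h2 := (isBigO_refl (fun t : ℝ => t⁻¹) (𝓝[≠] 0)).mul_isLittleO h
      refine h2.congr' ?_ ?_
      · filter_upwards [self_mem_nhdsWithin] with t ht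
        rw [Fin.sum_univ_succ, h0, zero_mul, zero_add, Finset.mul_sum]
        refine Finset.sum_congr rfl fun j _ => ?_
        rw [Fin.val_succ, pow_succ]
        have : t ≠ 0 := ht
        field_simp
      · filter_upwards [self_mem_nhdsWithin] with t ht
        have : t ≠ 0 := ht
        rw [pow_succ]
        field_simp
    ext j
    exact Fin.cases h0 (fun j => congrFun h1 j) j

/-- The coefficients of the quartic with depressed coefficients `y 0, y 1, y 2` translated
by `y 3`. -/
def translated (y : Fin 4 → ℝ) : Fin 4 → ℝ :=
  ![y 3 ^ 4 + y 2 * y 3 ^ 2 + y 1 * y 3 + y 0, 4 * y 3 ^ 3 + 2 * y 2 * y 3 + y 1,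
    6 * y 3 ^ 2 + y 2, 4 * y 3]

lemma quartic_translated (y : Fin 4 → ℝ) (t : ℝ) : quartic (translated y) t
    = (t + y 3) ^ 4 + y 2 * (t + y 3) ^ 2 + y 1 * (t + y 3) + y 0 := by
  simp [quartic, translated]
  ring

lemma contDiff_translated : ContDiff ℝ ∞ translated := by
  rw [contDiff_pi]
  intro j
  fin_cases j <;> simp [translated] <;> fun_prop

lemma exists_unfolding {ν : ℝ → Fin 3 → ℝ} (hν : ContDiff ℝ ∞ ν) {h : ℝ → ℝ}
    (hh : ContDiff ℝ ∞ h) :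
    ∃ (Q : ℝ × ((Fin 4 → ℝ) × (Fin 3 → ℝ)) → ℝ) (R : (Fin 4 → ℝ) × (Fin 3 → ℝ) → Fin 4 → ℝ),
      ContDiff ℝ ∞ Q ∧ ContDiff ℝ ∞ R ∧ ∀ (t : ℝ) (z : (Fin 4 → ℝ) × (Fin 3 → ℝ)), |t| ≤ 1 →
        ν t ⬝ᵥ z.2 - h t
          = quartic (translated z.1) t * Q (t, z) + ∑ j, R z j * t ^ (j : ℕ) := by
  choose Q r hQ hr hQr using fun i => exists_division (contDiff_pi.1 hν i)
  obtain ⟨Qh, rh, hQh, hrh, hQrh⟩ := exists_division hh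
  have htr : ContDiff ℝ ∞ fun z : (Fin 4 → ℝ) × (Fin 3 → ℝ) => translated z.1 :=
    contDiff_translated.comp contDiff_fst
  have htr' : ContDiff ℝ ∞ fun z : ℝ × ((Fin 4 → ℝ) × (Fin 3 → ℝ)) =>
      (z.1, translated z.2.1) := contDiff_fst.prodMk (htr.comp contDiff_snd)
  refine ⟨fun p => ∑ i, Q i (p.1, translated p.2.1) * p.2.2 i - Qh (p.1, translated p.2.1),
    fun z j => ∑ i, r i j (translated z.1) * z.2 i - rh j (translated z.1), ?_, ?_,
    fun t z ht => ?_⟩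
  · refine (ContDiff.sum fun i _ => ((hQ i).comp htr').mul ?_).sub (hQh.comp htr')
    fun_prop
  · rw [contDiff_pi]
    intro j
    refine (ContDiff.sum fun i _ => ((hr i j).comp htr).mul ?_).sub ((hrh j).comp htr)
    fun_prop
  · rw [hQrh t (translated z.1) ht]
    simp only [dotProduct, fun i => hQr i t (translated z.1) ht, Fin.sum_univ_three,
      Fin.sum_univ_four]
    ring

lemma unfolding_deriv {ν : ℝ → Fin 3 → ℝ} {h : ℝ → ℝ}
    {Q : ℝ × ((Fin 4 → ℝ) × (Fin 3 → ℝ)) → ℝ} {R : (Fin 4 → ℝ) × (Fin 3 → ℝ) → Fin 4 → ℝ}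
    (hQ : ContDiff ℝ ∞ Q) (hR : ContDiff ℝ ∞ R)
    (hQR : ∀ (t : ℝ) (z : (Fin 4 → ℝ) × (Fin 3 → ℝ)), |t| ≤ 1 → ν t ⬝ᵥ z.2 - h t
          = quartic (translated z.1) t * Q (t, z) + ∑ j, R z j * t ^ (j : ℕ))
    (x : Fin 3 → ℝ) (w : (Fin 4 → ℝ) × (Fin 3 → ℝ)) {t : ℝ} (ht : |t| ≤ 1) :
    ν t ⬝ᵥ w.2 = (w.1 0 + w.1 1 * t + w.1 2 * t ^ 2 + 4 * w.1 3 * t ^ 3) * Q (t, (0, x))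
      + t ^ 4 * fderiv ℝ Q (t, (0, x)) (0, w)
      + ∑ j, fderiv ℝ R (0, x) w j * t ^ (j : ℕ) := by
  have hz : HasDerivAt (fun e : ℝ => ((0, x) : (Fin 4 → ℝ) × (Fin 3 → ℝ)) + e • w) w 0 := by
    simpa using ((hasDerivAt_id (0 : ℝ)).smul_const w).const_add
      ((0, x) : (Fin 4 → ℝ) × (Fin 3 → ℝ))
  have hz0 : ((0, x) : (Fin 4 → ℝ) × (Fin 3 → ℝ)) + (0 : ℝ) • w = (0, x) := by simp
  have h1 : HasDerivAt (fun e : ℝ => ν t ⬝ᵥ (((0, x) : (Fin 4 → ℝ) × (Fin 3 → ℝ)) + e • w).2 - h t)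
      (ν t ⬝ᵥ w.2) 0 := by
    have : HasDerivAt (fun e : ℝ => ν t ⬝ᵥ x - h t + e * (ν t ⬝ᵥ w.2)) (ν t ⬝ᵥ w.2) 0 := by
      simpa using ((hasDerivAt_id (0 : ℝ)).mul_const (ν t ⬝ᵥ w.2)).const_add (ν t ⬝ᵥ x - h t)
    convert this using 2 with e
    simp [dotProduct_add, dotProduct_smul]
    ring
  have hP : HasDerivAt (fun e : ℝ =>
      quartic (translated (((0, x) : (Fin 4 → ℝ) × (Fin 3 → ℝ)) + e • w).1) t)
      (w.1 0 + w.1 1 * t + w.1 2 * t ^ 2 + 4 * w.1 3 * t ^ 3) 0 := by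
    simp only [quartic_translated]
    have hl : ∀ a : ℝ, HasDerivAt (fun e : ℝ => e * a) a 0 := fun a => by
      simpa using (hasDerivAt_id (0 : ℝ)).mul_const a
    have hT := (hl (w.1 3)).const_add t
    have := (((hT.pow 4).add ((hl (w.1 2)).mul (hT.pow 2))).add ((hl (w.1 1)).mul hT)).add
      (hl (w.1 0))
    refine (this.congr_deriv ?_).congr_of_eventuallyEq (Eventually.of_forall fun e => ?_)
    · simp
      ring
    · simp
  have hQd : HasDerivAt (fun e : ℝ => Q (t, ((0, x) : (Fin 4 → ℝ) × (Fin 3 → ℝ)) + e • w))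
      (fderiv ℝ Q (t, (0, x)) (0, w)) 0 := by
    have hf : HasFDerivAt Q (fderiv ℝ Q (t, (0, x)))
        (t, ((0, x) : (Fin 4 → ℝ) × (Fin 3 → ℝ)) + (0 : ℝ) • w) := by
      rw [hz0]
      exact (hQ.differentiable (by simp) _).hasFDerivAt
    exact hf.comp_hasDerivAt (0 : ℝ) ((hasDerivAt_const (0 : ℝ) t).prodMk hz)
  have hRd : HasDerivAt (fun e : ℝ => R (((0, x) : (Fin 4 → ℝ) × (Fin 3 → ℝ)) + e • w))
      (fderiv ℝ R (0, x) w) 0 := by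
    have hf : HasFDerivAt R (fderiv ℝ R (0, x))
        (((0, x) : (Fin 4 → ℝ) × (Fin 3 → ℝ)) + (0 : ℝ) • w) := by
      rw [hz0]
      exact (hR.differentiable (by simp) _).hasFDerivAt
    exact hf.comp_hasDerivAt (0 : ℝ) hz
  have h2 := (hP.mul hQd).add (HasDerivAt.fun_sum fun (j : Fin 4) (_ : j ∈ Finset.univ) =>
    ((hasDerivAt_pi.1 hRd j).mul_const (t ^ (j : ℕ))))
  have h3 := h1.unique (h2.congr_of_eventuallyEq (Eventually.of_forall fun e => hQR t _ ht))
  rw [h3, hz0, quartic_translated]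
  simp

end Unfolding

noncomputable section Swallowtail

open Asymptotics

/-- The standard swallowtail. -/
def swallowtail (p : ℝ × ℝ) : Fin 3 → ℝ :=
  ![p.1, p.2 ^ 3 + p.1 * p.2, p.2 ^ 4 + (2 / 3) * p.1 * p.2 ^ 2]

lemma eq_of_double_root {y : Fin 4 → ℝ} {t : ℝ} {A Q : ℝ → ℝ}
    (hA : A =ᶠ[𝓝 t] fun t' => quartic (translated y) t' * Q t') (hQ : DifferentiableAt ℝ Q t)
    (hQt : Q t ≠ 0) (h0 : A t = 0) (h1 : deriv A t = 0) :
    y 1 = -4 * (t + y 3) ^ 3 - 2 * y 2 * (t + y 3) ∧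
      y 0 = 3 * (t + y 3) ^ 4 + y 2 * (t + y 3) ^ 2 := by
  have hP : quartic (translated y) t = 0 := by
    have := hA.eq_of_nhds
    rw [h0] at this
    exact (mul_eq_zero.1 this.symm).resolve_right hQt
  have hP' : HasDerivAt (quartic (translated y))
      (4 * (t + y 3) ^ 3 + 2 * y 2 * (t + y 3) + y 1) t := by
    have hT : HasDerivAt (fun t : ℝ => t + y 3) 1 t := (hasDerivAt_id t).add_const _
    have := (((hT.pow 4).add ((hT.pow 2).const_mul (y 2))).add (hT.const_mul (y 1))).add_const (y 0)
    refine (this.congr_deriv ?_).congr_of_eventuallyEq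
      (Eventually.of_forall fun e => quartic_translated y e)
    simp
    ring
  have hd := hP'.mul hQ.hasDerivAt
  have h2 : deriv A t = _ := hA.deriv_eq.trans hd.deriv
  rw [h1, hP, zero_mul, add_zero] at h2
  have h3 := (mul_eq_zero.1 h2.symm).resolve_right hQt
  rw [quartic_translated] at hP
  constructor
  · linarith
  · linear_combination hP - (t + y 3) * h3

theorem locallyDiffeomorphic_swallowtail {ν : ℝ → Fin 3 → ℝ} (hν : ContDiff ℝ ∞ ν) {h : ℝ → ℝ}
    (hh : ContDiff ℝ ∞ h) {f : ℝ × ℝ → Fin 3 → ℝ} (hf : ContDiff ℝ ∞ f) {a : ℝ} (ha : a ≠ 0)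
    (hx : (fun t => ν t ⬝ᵥ f (0, 0) - h t - a * t ^ 4) =o[𝓝 0] fun t => t ^ 4)
    (hind : ∀ v, ((fun t => ν t ⬝ᵥ v) =O[𝓝 0] fun t => t ^ 3) → v = 0)
    (h0 : ∀ t s, ν t ⬝ᵥ f (t, s) = h t)
    (h1 : ∀ t s, deriv (fun t' => ν t' ⬝ᵥ f (t, s) - h t') t = 0)
    (hf1 : fderiv ℝ f (0, 0) (1, 0) = 0) (hf2 : fderiv ℝ f (0, 0) (0, 1) ≠ 0) :
    LocallyDiffeomorphic f (0, 0) swallowtail (0, 0) := by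
  obtain ⟨Q, R, hQ, hR, hQR⟩ := exists_unfolding hν hh
  set x₀ := f (0, 0) with hx₀
  set z₀ : (Fin 4 → ℝ) × (Fin 3 → ℝ) := (0, x₀) with hz₀
  have hsmall : ∀ᶠ t : ℝ in 𝓝 0, |t| ≤ 1 := by
    filter_upwards [Metric.ball_mem_nhds (0 : ℝ) one_pos] with t ht
    simpa using (mem_ball_zero_iff.1 ht).le
  have hquad : ∀ t : ℝ, quartic (translated z₀.1) t = t ^ 4 := fun t => by
    simp [quartic_translated, hz₀]
  have h43 : (fun t : ℝ => t ^ 4) =o[𝓝 0] fun t => t ^ 3 := isLittleO_pow_pow (by norm_num)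
  have hbdd : ∀ {φ : ℝ → ℝ}, Continuous φ → ∀ n : ℕ,
      (fun t : ℝ => t ^ n * φ t) =O[𝓝 0] fun t => t ^ n := fun {φ} hφ n => by
    simpa using (isBigO_refl (fun t : ℝ => t ^ n) (𝓝 0)).mul
      ((hφ.tendsto 0).isBigO_one ℝ)
  have hQc : Continuous fun t => Q (t, z₀) :=
    hQ.continuous.comp (continuous_id.prodMk continuous_const)
  have hRz : R z₀ = 0 := by
    refine eq_zero_of_sum_mul_pow_isLittleO ?_
    have e : (fun t : ℝ => (ν t ⬝ᵥ x₀ - h t - a * t ^ 4) + a * t ^ 4 - t ^ 4 * Q (t, z₀))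
        =O[𝓝 0] fun t => t ^ 4 :=
      (hx.isBigO.add (isBigO_const_mul_self a _ _)).sub (hbdd hQc 4)
    refine ((e.trans_isLittleO h43).congr' ?_ EventuallyEq.rfl).mono nhdsWithin_le_nhds
    filter_upwards [hsmall] with t ht
    have := hQR t z₀ ht
    rw [hquad] at this
    simp only [hz₀] at this ⊢
    linarith
  have hQz : Q (0, z₀) = a := by
    have e : (fun t : ℝ => Q (t, z₀) - a) =o[𝓝[≠] 0] fun _ => (1 : ℝ) := by
      have e1 := (isBigO_refl (fun t : ℝ => (t ^ 4)⁻¹) (𝓝[≠] 0)).mul_isLittleO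
        (hx.mono nhdsWithin_le_nhds)
      refine e1.congr' ?_ ?_
      · filter_upwards [self_mem_nhdsWithin, hsmall.filter_mono nhdsWithin_le_nhds] with t ht ht1
        have ht0 : t ≠ 0 := ht
        have := hQR t z₀ ht1
        rw [hquad, hRz] at this
        simp only [hz₀, Pi.zero_apply, zero_mul, Finset.sum_const_zero, add_zero] at this ⊢
        rw [this]
        field_simp
      · filter_upwards [self_mem_nhdsWithin] with t ht
        have ht0 : t ≠ 0 := ht
        field_simp
    have l1 := (isLittleO_one_iff ℝ).1 e
    have l2 : Tendsto (fun t => Q (t, z₀) - a) (𝓝[≠] 0) (𝓝 (Q (0, z₀) - a)) :=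
      ((hQc.sub continuous_const).tendsto 0).mono_left nhdsWithin_le_nhds
    exact sub_eq_zero.1 (tendsto_nhds_unique l2 l1)
  have hKc : ∀ w, Continuous fun t : ℝ => fderiv ℝ Q (t, z₀) (0, w) := fun w =>
    ((hQ.continuous_fderiv (by simp)).comp (continuous_id.prodMk continuous_const)).clm_apply
      continuous_const
  -- the linearised unfolding determines `w.1` from `w.2` along `ker dR`
  have hw1 : ∀ w, fderiv ℝ R z₀ w = 0 → w.2 = 0 → w = 0 := by
    intro w hw hw2
    have e : (fun t : ℝ => ∑ j, (![w.1 0, w.1 1, w.1 2, 4 * w.1 3] : Fin 4 → ℝ) j * t ^ (j : ℕ))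
        =o[𝓝[≠] 0] fun t => t ^ 3 := by
      have hQi : (fun t => (Q (t, z₀))⁻¹) =O[𝓝 0] fun _ => (1 : ℝ) :=
        ((hQc.tendsto 0).inv₀ (by rw [hQz]; exact ha)).isBigO_one ℝ
      have e1 : (fun t : ℝ => t ^ 4 * fderiv ℝ Q (t, z₀) (0, w)) =o[𝓝 0] fun t => t ^ 3 :=
        (hbdd (hKc w) 4).trans_isLittleO h43
      have e2 := (hQi.mul_isLittleO e1).neg_left
      simp only [one_mul] at e2
      refine (e2.congr' ?_ EventuallyEq.rfl).mono nhdsWithin_le_nhds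
      filter_upwards [hsmall, hQc.continuousAt.eventually_ne (by rw [hQz]; exact ha)] with t ht hQt
      have := unfolding_deriv hQ hR hQR x₀ w ht
      rw [← hz₀, hw, hw2] at this
      simp only [dotProduct_zero, Pi.zero_apply, zero_mul, Finset.sum_const_zero, add_zero] at this
      have h5 : t ^ 4 * fderiv ℝ Q (t, z₀) (0, w)
        = -((w.1 0 + w.1 1 * t + w.1 2 * t ^ 2 + 4 * w.1 3 * t ^ 3) * Q (t, z₀)) := by linarith
      rw [h5]
      simp [Fin.sum_univ_four]
      field_simp
    have hz := eq_zero_of_sum_mul_pow_isLittleO e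
    refine Prod.ext ?_ hw2
    have q0 := congrFun hz 0
    have q1 := congrFun hz 1
    have q2 := congrFun hz 2
    have q3 := congrFun hz 3
    simp at q0 q1 q2 q3
    ext i
    fin_cases i <;> simpa
  have hw2 : ∀ w, fderiv ℝ R z₀ w = 0 → w.1 0 = 0 → w.1 1 = 0 → w.1 2 = 0 → w = 0 := by
    intro w hw q0 q1 q2
    refine hw1 w hw (hind _ ?_)
    have e := hbdd (φ := fun t => 4 * w.1 3 * Q (t, z₀) + t * fderiv ℝ Q (t, z₀) (0, w))
      ((continuous_const.mul hQc).add (continuous_id.mul (hKc w))) 3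
    refine e.congr' ?_ EventuallyEq.rfl
    filter_upwards [hsmall] with t ht
    have := unfolding_deriv hQ hR hQR x₀ w ht
    rw [← hz₀, hw, q0, q1, q2] at this
    simp only [Pi.zero_apply, zero_mul, Finset.sum_const_zero, add_zero] at this
    rw [this]
    ring
  -- solving `R (y x, x) = 0`
  have hΨ : ContDiff ℝ ∞ fun z : (Fin 4 → ℝ) × (Fin 3 → ℝ) => (R z, z.2) :=
    hR.prodMk contDiff_snd
  have hRd : HasFDerivAt R (fderiv ℝ R z₀) z₀ := (hR.differentiable (by simp) _).hasFDerivAt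
  have hΨd : fderiv ℝ (fun z : (Fin 4 → ℝ) × (Fin 3 → ℝ) => (R z, z.2)) z₀
      = (fderiv ℝ R z₀).prod (ContinuousLinearMap.snd ℝ _ _) :=
    (hRd.prodMk hasFDerivAt_snd).fderiv
  obtain ⟨U, Γ, -, hzU, -, hΓl, hΓo, hΓ⟩ := exists_smooth_leftInverse isOpen_univ
    hΨ.contDiffOn (mem_univ z₀) (by
      rw [hΨd]
      refine (injective_iff_map_eq_zero _).2 fun w hw => ?_
      exact hw1 w (congrArg Prod.fst hw) (congrArg Prod.snd hw))
  set O := (fun z : (Fin 4 → ℝ) × (Fin 3 → ℝ) => (R z, z.2)) '' U with hO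
  have hι : ContDiff ℝ ∞ fun x : Fin 3 → ℝ => ((0 : Fin 4 → ℝ), x) :=
    contDiff_const.prodMk contDiff_id
  set W₀ := (fun x : Fin 3 → ℝ => ((0 : Fin 4 → ℝ), x)) ⁻¹' O with hW₀
  have hW₀o : IsOpen W₀ := hΓo.preimage hι.continuous
  set y : (Fin 3 → ℝ) → Fin 4 → ℝ := fun x => (Γ (0, x)).1 with hy
  have hyc : ContDiffOn ℝ ∞ y W₀ :=
    contDiff_fst.comp_contDiffOn (hΓ.comp hι.contDiffOn fun x hx => hx)
  have hRy : ∀ x ∈ W₀, R (y x, x) = 0 := by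
    rintro x ⟨z, hzU, hz⟩
    have hz1 : R z = 0 := congrArg Prod.fst hz
    have hz2 : z.2 = x := congrArg Prod.snd hz
    have : Γ (0, x) = z := by rw [← hΓl z hzU]; exact congrArg Γ hz.symm
    have hzz : (y x, x) = z := Prod.ext (congrArg (fun w => w.1) this) hz2.symm
    rw [hzz, hz1]
  have hx₀W : x₀ ∈ W₀ := ⟨z₀, hzU, Prod.ext hRz rfl⟩
  have hyx₀ : y x₀ = 0 := by
    have h5 := hΓl z₀ hzU
    simp only [hRz] at h5
    exact congrArg Prod.fst h5
  have hyd : HasFDerivAt y (fderiv ℝ y x₀) x₀ :=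
    ((hyc.contDiffAt (hW₀o.mem_nhds hx₀W)).differentiableAt (by simp)).hasFDerivAt
  have hRyd : ∀ v, fderiv ℝ R z₀ (fderiv ℝ y x₀ v, v) = 0 := by
    intro v
    have e1 : HasFDerivAt R (fderiv ℝ R z₀) (y x₀, x₀) := by rw [hyx₀]; exact hRd
    have e2 := HasFDerivAt.comp (g := R) (f := fun x => (y x, x)) x₀ e1
      (hyd.prodMk (hasFDerivAt_id x₀))
    have e3 : HasFDerivAt (R ∘ fun x => (y x, x)) (0 : (Fin 3 → ℝ) →L[ℝ] Fin 4 → ℝ) x₀ :=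
      (hasFDerivAt_const (0 : Fin 4 → ℝ) x₀).congr_of_eventuallyEq (by
        filter_upwards [hW₀o.mem_nhds hx₀W] with x hx using hRy x hx)
    exact congrArg (fun L : (Fin 3 → ℝ) →L[ℝ] Fin 4 → ℝ => L v) (e2.unique e3)
  set τ : (Fin 3 → ℝ) → Fin 3 → ℝ := fun x => ![y x 2 / 2, -(y x 1) / 4, y x 0 / 3] with hτ
  have hyi : ∀ i, ContDiffOn ℝ ∞ (fun x => y x i) W₀ := contDiffOn_pi.1 hyc
  have hτc : ContDiffOn ℝ ∞ τ W₀ := by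
    rw [contDiffOn_pi]
    intro i
    fin_cases i
    · exact (hyi 2).div_const 2
    · exact (hyi 1).neg.div_const 4
    · exact (hyi 0).div_const 3
  have hyid : ∀ i, HasFDerivAt (fun x => y x i)
      ((ContinuousLinearMap.proj i).comp (fderiv ℝ y x₀)) x₀ := hasFDerivAt_pi'.1 hyd
  have hτd : HasFDerivAt τ (fderiv ℝ τ x₀) x₀ :=
    ((hτc.contDiffAt (hW₀o.mem_nhds hx₀W)).differentiableAt (by simp)).hasFDerivAt
  have hτv : ∀ v, fderiv ℝ τ x₀ v = 0 → v = 0 := by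
    intro v hv
    have hτi := fun i => hasFDerivAt_pi'.1 hτd i
    have c0 := congrArg (fun L : (Fin 3 → ℝ) →L[ℝ] ℝ => L v)
      ((hτi 0).unique (((hyid 2).mul_const (2⁻¹ : ℝ))))
    have c1 := congrArg (fun L : (Fin 3 → ℝ) →L[ℝ] ℝ => L v)
      ((hτi 1).unique (((hyid 1).neg.mul_const (4⁻¹ : ℝ))))
    have c2 := congrArg (fun L : (Fin 3 → ℝ) →L[ℝ] ℝ => L v)
      ((hτi 2).unique (((hyid 0).mul_const (3⁻¹ : ℝ))))
    simp [hv] at c0 c1 c2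
    exact congrArg Prod.snd (hw2 _ (hRyd v) c2 c1 c0)
  set σ : ℝ × ℝ → ℝ × ℝ := fun p => (y (f p) 2 / 2, p.1 + y (f p) 3) with hσ
  have hfW : IsOpen (f ⁻¹' W₀) := hW₀o.preimage hf.continuous
  have hyf : ∀ i, ContDiffOn ℝ ∞ (fun p => y (f p) i) (f ⁻¹' W₀) := fun i =>
    (hyi i).comp hf.contDiffOn fun p hp => hp
  have hσc : ContDiffOn ℝ ∞ σ (f ⁻¹' W₀) :=
    ((hyf 2).div_const 2).prodMk (contDiff_fst.contDiffOn.add (hyf 3))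
  have hQV : ContinuousOn (fun p : ℝ × ℝ => Q (p.1, (y (f p), f p))) (f ⁻¹' W₀) :=
    hQ.continuous.comp_continuousOn (continuous_fst.continuousOn.prodMk
      ((continuousOn_pi.2 fun i => (hyf i).continuousOn).prodMk hf.continuous.continuousOn))
  set V := (f ⁻¹' W₀ ∩ (fun p : ℝ × ℝ => Q (p.1, (y (f p), f p))) ⁻¹' {0}ᶜ)
    ∩ {p : ℝ × ℝ | |p.1| < 1} with hV
  have hVo : IsOpen V := (hQV.isOpen_inter_preimage hfW isOpen_compl_singleton).inter
    (isOpen_lt (continuous_fst.abs) continuous_const)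
  have h0V : ((0, 0) : ℝ × ℝ) ∈ V := by
    refine ⟨⟨hx₀W, ?_⟩, by simp⟩
    simp only [mem_preimage, mem_compl_iff, mem_singleton_iff]
    rw [← hx₀, hyx₀, ← hz₀, hQz]
    exact ha
  have hVW : V ⊆ f ⁻¹' W₀ := fun p hp => hp.1.1
  have hcomm : ∀ p ∈ V, τ (f p) = swallowtail (σ p) := by
    rintro ⟨t, s⟩ ⟨⟨hp, hpQ⟩, hpt⟩
    have key := eq_of_double_root (y := y (f (t, s))) (t := t)
      (A := fun t' => ν t' ⬝ᵥ f (t, s) - h t') (Q := fun t' => Q (t', (y (f (t, s)), f (t, s))))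
      (by
        filter_upwards [(isOpen_lt continuous_abs continuous_const).mem_nhds
          (show |t| < 1 from hpt)] with t' ht'
        have := hQR t' (y (f (t, s)), f (t, s)) (le_of_lt ht')
        rw [hRy _ hp] at this
        simpa using this)
      ((hQ.differentiable (by simp)).comp
        (differentiable_id.prodMk (differentiable_const _)) t)
      hpQ (by simp [h0]) (h1 t s)
    simp only [hτ, hσ, swallowtail]
    ext i
    fin_cases i
    · rfl
    · simp [key.1]
      ring
    · simp [key.2]
      ring
  have hσ0 : σ (0, 0) = (0, 0) := by
    simp only [hσ]
    rw [← hx₀, hyx₀]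
    simp
  have hσd : HasFDerivAt σ (fderiv ℝ σ (0, 0)) (0, 0) :=
    ((hσc.contDiffAt (hfW.mem_nhds (hVW h0V))).differentiableAt (by simp)).hasFDerivAt
  have hfd : HasFDerivAt f (fderiv ℝ f (0, 0)) (0, 0) :=
    (hf.differentiable (by simp) _).hasFDerivAt
  have hσ10 : fderiv ℝ σ (0, 0) (1, 0) = (0, 1) := by
    have e := ((hyd.comp (0, 0) hfd))
    have e3 := fun i => hasFDerivAt_pi'.1 e i
    have e4 : HasFDerivAt σ _ (0, 0) :=
      ((e3 2).mul_const (2⁻¹ : ℝ)).prodMk (hasFDerivAt_fst.add (e3 3))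
    rw [e4.fderiv]
    simp [hf1]
  refine locallyDiffeomorphic_of_injective_fderiv hVo h0V hW₀o hx₀W hf.continuous.continuousOn
    (hσc.mono hVW) hτc ((injective_iff_map_eq_zero _).2 ?_)
    ((injective_iff_map_eq_zero _).2 hτv) hσ0 hcomm
  rintro ⟨r, s⟩ hrs
  have hsw : HasFDerivAt swallowtail (fderiv ℝ swallowtail (0, 0)) (σ (0, 0)) := by
    rw [hσ0]
    refine DifferentiableAt.hasFDerivAt ?_
    rw [differentiableAt_pi]
    intro i
    fin_cases i <;> simp [swallowtail] <;> fun_prop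
  have e1 := hτd.comp (0, 0) hfd
  have e2 := (hsw.comp (0, 0) hσd).congr_of_eventuallyEq (by
    filter_upwards [hVo.mem_nhds h0V] with p hp using hcomm p hp)
  have e3 := congrArg (fun L : ℝ × ℝ →L[ℝ] Fin 3 → ℝ => L (r, s)) (e1.unique e2)
  simp only [ContinuousLinearMap.comp_apply, hrs, map_zero] at e3
  have hdec : ((r, s) : ℝ × ℝ) = r • (1, 0) + s • (0, 1) := by simp
  have hs := hτv _ e3
  rw [hdec, map_add, map_smul, map_smul, hf1, smul_zero, zero_add, smul_eq_zero] at hs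
  have hs0 : s = 0 := hs.resolve_right hf2
  rw [hdec, hs0, map_add, map_smul, map_smul, hσ10] at hrs
  have hr0 : r = 0 := by simpa using congrArg Prod.snd hrs
  rw [hr0, hs0]
  rfl

end Swallowtail

section TangentSurface

open Asymptotics Matrix

lemma ContDiff.deriv_infty {E : Type*} [NormedAddCommGroup E] [NormedSpace ℝ E] {φ : ℝ → E}
    (h : ContDiff ℝ ∞ φ) : ContDiff ℝ ∞ (deriv φ) :=
  (contDiff_infty_iff_deriv.1 h).2

lemma ContDiff.hasDerivAt_deriv {E : Type*} [NormedAddCommGroup E] [NormedSpace ℝ E] {φ : ℝ → E}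
    (h : ContDiff ℝ ∞ φ) (t : ℝ) : HasDerivAt φ (deriv φ t) t :=
  (h.differentiable (by simp) t).hasDerivAt

lemma hasDerivAt_cross {a b : ℝ → Fin 3 → ℝ} {a' b' : Fin 3 → ℝ} {t : ℝ}
    (ha : HasDerivAt a a' t) (hb : HasDerivAt b b' t) :
    HasDerivAt (fun t => a t ⨯₃ b t) (a' ⨯₃ b t + a t ⨯₃ b') t := by
  have ha := hasDerivAt_pi.1 ha
  have hb := hasDerivAt_pi.1 hb
  simp only [cross_apply]
  refine hasDerivAt_pi.2 fun i => ?_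
  fin_cases i
  · exact (((ha 1).mul (hb 2)).sub ((ha 2).mul (hb 1))).congr_deriv (by simp; ring)
  · exact (((ha 2).mul (hb 0)).sub ((ha 0).mul (hb 2))).congr_deriv (by simp; ring)
  · exact (((ha 0).mul (hb 1)).sub ((ha 1).mul (hb 0))).congr_deriv (by simp; ring)

lemma hasDerivAt_dotProduct {n : ℕ} {a b : ℝ → Fin n → ℝ} {a' b' : Fin n → ℝ} {t : ℝ}
    (ha : HasDerivAt a a' t) (hb : HasDerivAt b b' t) :
    HasDerivAt (fun t => a t ⬝ᵥ b t) (a' ⬝ᵥ b t + a t ⬝ᵥ b') t := by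
  have := HasDerivAt.fun_sum fun i (_ : i ∈ Finset.univ) =>
    (hasDerivAt_pi.1 ha i).mul (hasDerivAt_pi.1 hb i)
  exact this.congr_deriv (by simp [dotProduct, Finset.sum_add_distrib])

lemma contDiff_cross {a b : ℝ → Fin 3 → ℝ} (ha : ContDiff ℝ ∞ a) (hb : ContDiff ℝ ∞ b) :
    ContDiff ℝ ∞ fun t => a t ⨯₃ b t := by
  have ha := contDiff_pi.1 ha
  have hb := contDiff_pi.1 hb
  simp only [cross_apply]
  refine contDiff_pi.2 fun i => ?_
  fin_cases i
  · exact ((ha 1).mul (hb 2)).sub ((ha 2).mul (hb 1))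
  · exact ((ha 2).mul (hb 0)).sub ((ha 0).mul (hb 2))
  · exact ((ha 0).mul (hb 1)).sub ((ha 1).mul (hb 0))

lemma contDiff_dotProduct {n : ℕ} {a b : ℝ → Fin n → ℝ} (ha : ContDiff ℝ ∞ a)
    (hb : ContDiff ℝ ∞ b) : ContDiff ℝ ∞ fun t => a t ⬝ᵥ b t :=
  ContDiff.sum fun i _ => (contDiff_pi.1 ha i).mul (contDiff_pi.1 hb i)

lemma eq_zero_of_cross_dotProduct {a b c d w : Fin 3 → ℝ} (hΔ : a ⬝ᵥ b ⨯₃ c ≠ 0)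
    (h0 : (a ⨯₃ b) ⬝ᵥ w = 0) (h1 : (a ⨯₃ c) ⬝ᵥ w = 0)
    (h2 : (b ⨯₃ c + a ⨯₃ d) ⬝ᵥ w = 0) : w = 0 := by
  have key : ∀ i, (a ⬝ᵥ b ⨯₃ c) * w i = ((b ⨯₃ c) ⬝ᵥ w) * a i := fun i => by
    have e : (a ⬝ᵥ b ⨯₃ c) * w i
        = ((b ⨯₃ c) ⬝ᵥ w) * a i - ((a ⨯₃ c) ⬝ᵥ w) * b i + ((a ⨯₃ b) ⬝ᵥ w) * c i := by
      simp only [cross_apply, vec3_dotProduct]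
      fin_cases i <;> dsimp <;> ring
    rw [e, h0, h1]
    ring
  have h3 : (a ⬝ᵥ b ⨯₃ c) * ((a ⨯₃ d) ⬝ᵥ w) = 0 := by
    have k0 := key 0
    have k1 := key 1
    have k2 := key 2
    set Δ := a ⬝ᵥ b ⨯₃ c
    set α := (b ⨯₃ c) ⬝ᵥ w
    simp only [cross_apply, vec3_dotProduct]
    dsimp only [Matrix.cons_val]
    linear_combination (a 1 * d 2 - a 2 * d 1) * k0 + (a 2 * d 0 - a 0 * d 2) * k1
      + (a 0 * d 1 - a 1 * d 0) * k2
  have h4 := (mul_eq_zero.1 h3).resolve_left hΔ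
  rw [add_dotProduct, h4, add_zero] at h2
  ext i
  have := key i
  rw [h2, zero_mul] at this
  exact (mul_eq_zero.1 this).resolve_left hΔ

lemma isLittleO_sub_taylor {φ : ℝ → ℝ} (hφ : ContDiff ℝ ∞ φ) (n : ℕ) :
    (fun t => φ t - ∑ k : Fin (n + 1), ((k : ℕ).factorial : ℝ)⁻¹ * iteratedDeriv k φ 0
      * t ^ (k : ℕ)) =o[𝓝 0] fun t => t ^ n := by
  have := taylor_isLittleO_univ (x₀ := 0) (n := n) (hφ.of_le (by exact_mod_cast le_top))
  simp only [sub_zero, taylor_within_apply, iteratedDerivWithin_univ, smul_eq_mul] at this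
  refine this.congr_left fun t => ?_
  rw [Finset.sum_range]
  congr 1
  exact Finset.sum_congr rfl fun k _ => by ring

lemma iteratedDeriv_eq_zero_of_isLittleO {φ : ℝ → ℝ} (hφ : ContDiff ℝ ∞ φ) {n : ℕ}
    (h : φ =o[𝓝 0] fun t => t ^ n) {k : ℕ} (hk : k ≤ n) : iteratedDeriv k φ 0 = 0 := by
  have e := (h.sub (isLittleO_sub_taylor hφ n)).mono (nhdsWithin_le_nhds (s := {0}ᶜ))
  simp only [sub_sub_cancel] at e
  have := congrFun (eq_zero_of_sum_mul_pow_isLittleO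
    (a := fun k : Fin (n + 1) => ((k : ℕ).factorial : ℝ)⁻¹ * iteratedDeriv k φ 0) e)
    ⟨k, Nat.lt_succ_of_le hk⟩
  exact (mul_eq_zero.1 this).resolve_left (inv_ne_zero (by positivity))

lemma triple_product_ne_zero {γ u : ℝ → Fin 3 → ℝ} (hu : ContDiff ℝ ∞ u) {c : ℝ → ℝ}
    (hc : ContDiff ℝ ∞ c) (hcu : ∀ t, deriv γ t = c t • u t) (hc0 : c 0 = 0)
    (hindep : LinearIndependent ℝ
      ![iteratedDeriv 2 γ 0, iteratedDeriv 3 γ 0, iteratedDeriv 4 γ 0]) :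
    u 0 ⬝ᵥ deriv u 0 ⨯₃ deriv (deriv u) 0 ≠ 0 := by
  have hu1 := ContDiff.deriv_infty hu
  have hu2 := ContDiff.deriv_infty hu1
  have hc1 := ContDiff.deriv_infty hc
  have hc2 := ContDiff.deriv_infty hc1
  have du := ContDiff.hasDerivAt_deriv hu
  have du1 := ContDiff.hasDerivAt_deriv hu1
  have du2 := ContDiff.hasDerivAt_deriv hu2
  have dc := ContDiff.hasDerivAt_deriv hc
  have dc1 := ContDiff.hasDerivAt_deriv hc1
  have dc2 := ContDiff.hasDerivAt_deriv hc2
  set u1 := deriv u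
  set u2 := deriv u1
  set u3 := deriv u2
  set c1 := deriv c
  set c2 := deriv c1
  set c3 := deriv c2
  have g1 : deriv γ = fun t => c t • u t := funext hcu
  have g2 : deriv (fun t => c t • u t) = fun t => c t • u1 t + c1 t • u t :=
    funext fun t => ((dc t).smul (du t)).deriv
  have g3 : deriv (fun t => c t • u1 t + c1 t • u t)
      = fun t => c t • u2 t + c1 t • u1 t + (c1 t • u1 t + c2 t • u t) :=
    funext fun t => (((dc t).smul (du1 t)).add ((dc1 t).smul (du t))).deriv
  have g4 : deriv (fun t => c t • u2 t + c1 t • u1 t + (c1 t • u1 t + c2 t • u t))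
      = fun t => c t • u3 t + c1 t • u2 t + (c1 t • u2 t + c2 t • u1 t)
        + ((c1 t • u2 t + c2 t • u1 t) + (c2 t • u1 t + c3 t • u t)) :=
    funext fun t => ((((dc t).smul (du2 t)).add ((dc1 t).smul (du1 t))).add
      (((dc1 t).smul (du1 t)).add ((dc2 t).smul (du t)))).deriv
  simp only [iteratedDeriv_succ', iteratedDeriv_zero, g1, g2, g3, g4] at hindep
  have hdet := (Matrix.isUnit_iff_isUnit_det _).1
    (Matrix.linearIndependent_rows_iff_isUnit (A := Matrix.of _) |>.1 hindep)
  intro h0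
  refine hdet.ne_zero ?_
  change Matrix.det ![_, _, _] = 0
  rw [← triple_product_eq_det]
  simp only [hc0]
  simp only [cross_apply, vec3_dotProduct] at h0 ⊢
  simp at h0 ⊢
  linear_combination 6 * (c1 0) ^ 3 * h0

theorem locallyDiffeomorphic_tangentSurface {γ : ℝ → Fin 3 → ℝ} (hγ : ContDiff ℝ ∞ γ)
    {u : ℝ → Fin 3 → ℝ} (hu : ContDiff ℝ ∞ u) {c : ℝ → ℝ} (hc : ContDiff ℝ ∞ c)
    (hcu : ∀ t, deriv γ t = c t • u t) (hu0 : u 0 ≠ 0) (hc0 : c 0 = 0)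
    (hc1 : deriv c 0 ≠ 0)
    (hindep : LinearIndependent ℝ
      ![iteratedDeriv 2 γ 0, iteratedDeriv 3 γ 0, iteratedDeriv 4 γ 0]) :
    LocallyDiffeomorphic (fun p : ℝ × ℝ => γ p.1 + p.2 • u p.1) (0, 0) swallowtail (0, 0) := by
  have hΔ := triple_product_ne_zero hu hc hcu hc0 hindep
  have hu1 := ContDiff.deriv_infty hu
  have hu2 := ContDiff.deriv_infty hu1
  have hu3 := ContDiff.deriv_infty hu2
  have du := ContDiff.hasDerivAt_deriv hu
  have du1 := ContDiff.hasDerivAt_deriv hu1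
  have du2 := ContDiff.hasDerivAt_deriv hu2
  have dc := ContDiff.hasDerivAt_deriv hc
  have dγ : ∀ t, HasDerivAt γ (c t • u t) t := fun t => by
    rw [← hcu]; exact ContDiff.hasDerivAt_deriv hγ t
  set u1 := deriv u
  set u2 := deriv u1
  set u3 := deriv u2
  set ν := fun t => u t ⨯₃ u1 t with hν
  set N1 := fun t => u t ⨯₃ u2 t with hN1
  set N2 := fun t => u1 t ⨯₃ u2 t + u t ⨯₃ u3 t with hN2
  have cν : ContDiff ℝ ∞ ν := contDiff_cross hu hu1
  have cN2 : ContDiff ℝ ∞ N2 := (contDiff_cross hu1 hu2).add (contDiff_cross hu hu3)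
  have cN3 := ContDiff.deriv_infty cN2
  have dν : ∀ t, HasDerivAt ν (N1 t) t := fun t =>
    (hasDerivAt_cross (du t) (du1 t)).congr_deriv (by simp [hN1])
  have dN1 : ∀ t, HasDerivAt N1 (N2 t) t := fun t => hasDerivAt_cross (du t) (du2 t)
  have dN2 := ContDiff.hasDerivAt_deriv cN2
  have dN3 := ContDiff.hasDerivAt_deriv cN3
  have hνu : ∀ t, ν t ⬝ᵥ u t = 0 := fun t => by rw [dotProduct_comm]; simp [hν]
  have hN1u : ∀ t, N1 t ⬝ᵥ u t = 0 := fun t => by rw [dotProduct_comm]; simp [hN1]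
  have hN2u : N2 0 ⬝ᵥ u 0 ≠ 0 := by
    rw [dotProduct_comm]
    simpa [hN2, dotProduct_add] using hΔ
  have hf : ContDiff ℝ ∞ fun p : ℝ × ℝ => γ p.1 + p.2 • u p.1 :=
    (hγ.comp contDiff_fst).add (contDiff_snd.smul (hu.comp contDiff_fst))
  have hfd : HasFDerivAt (fun p : ℝ × ℝ => γ p.1 + p.2 • u p.1)
    (fderiv ℝ (fun p : ℝ × ℝ => γ p.1 + p.2 • u p.1) (0, 0)) (0, 0) :=
    (hf.differentiable (by simp) _).hasFDerivAt
  refine locallyDiffeomorphic_swallowtail (ν := ν) (h := fun t => ν t ⬝ᵥ γ t)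
    (a := -(deriv c 0 * (N2 0 ⬝ᵥ u 0)) / 24) cν (contDiff_dotProduct cν hγ) hf ?_ ?_ ?_ ?_ ?_ ?_ ?_
  · exact div_ne_zero (neg_ne_zero.2 (mul_ne_zero hc1 hN2u)) (by norm_num)
  · have dE : ∀ t, HasDerivAt (fun t => γ t - γ 0) (c t • u t) t := fun t => (dγ t).sub_const _
    have cE : ContDiff ℝ ∞ fun t => γ t - γ 0 := hγ.sub contDiff_const
    have g1 : deriv (fun t => -(ν t ⬝ᵥ (γ t - γ 0))) = fun t => -(N1 t ⬝ᵥ (γ t - γ 0)) :=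
      funext fun t => by
        rw [(hasDerivAt_dotProduct (dν t) (dE t)).fun_neg.deriv]
        simp [hνu]
    have g2 : deriv (fun t => -(N1 t ⬝ᵥ (γ t - γ 0))) = fun t => -(N2 t ⬝ᵥ (γ t - γ 0)) :=
      funext fun t => by
        rw [(hasDerivAt_dotProduct (dN1 t) (dE t)).fun_neg.deriv]
        simp [hN1u]
    have g3 : deriv (fun t => -(N2 t ⬝ᵥ (γ t - γ 0)))
        = fun t => -(deriv N2 t ⬝ᵥ (γ t - γ 0) + c t * (N2 t ⬝ᵥ u t)) :=
      funext fun t => by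
        rw [(hasDerivAt_dotProduct (dN2 t) (dE t)).fun_neg.deriv]
        simp
    have g4 : deriv (fun t => -(deriv N2 t ⬝ᵥ (γ t - γ 0) + c t * (N2 t ⬝ᵥ u t))) 0
        = -(deriv c 0 * (N2 0 ⬝ᵥ u 0)) := by
      rw [((hasDerivAt_dotProduct (dN3 0) (dE 0)).fun_add
        ((dc 0).fun_mul (hasDerivAt_dotProduct (dN2 0) (du 0)))).fun_neg.deriv]
      simp [hc0]
    have := isLittleO_sub_taylor (contDiff_dotProduct cν cE).neg 4
    refine this.congr_left fun t => ?_
    simp only [Fin.sum_univ_castSucc, Fin.sum_univ_zero, Fin.val_castSucc, Fin.val_last,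
      iteratedDeriv_succ', iteratedDeriv_zero, g1, g2, g3, g4, hc0, sub_self, dotProduct_zero]
    simp [dotProduct_sub, Nat.factorial]
    ring
  · intro w hw
    have cw : ContDiff ℝ ∞ fun t => ν t ⬝ᵥ w := contDiff_dotProduct cν contDiff_const
    have hw2 : (fun t => ν t ⬝ᵥ w) =o[𝓝 0] fun t => t ^ 2 :=
      hw.trans_isLittleO (isLittleO_pow_pow (by norm_num))
    have g1 : deriv (fun t => ν t ⬝ᵥ w) = fun t => N1 t ⬝ᵥ w := funext fun t => by
      rw [(hasDerivAt_dotProduct (dν t) (hasDerivAt_const t w)).deriv]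
      simp
    have g2 : deriv (fun t => N1 t ⬝ᵥ w) = fun t => N2 t ⬝ᵥ w := funext fun t => by
      rw [(hasDerivAt_dotProduct (dN1 t) (hasDerivAt_const t w)).deriv]
      simp
    have e0 := iteratedDeriv_eq_zero_of_isLittleO cw hw2 (k := 0) (by norm_num)
    have e1 := iteratedDeriv_eq_zero_of_isLittleO cw hw2 (k := 1) (by norm_num)
    have e2 := iteratedDeriv_eq_zero_of_isLittleO cw hw2 (k := 2) (by norm_num)
    simp only [iteratedDeriv_succ', iteratedDeriv_zero, g1, g2] at e0 e1 e2
    exact eq_zero_of_cross_dotProduct hΔ e0 e1 e2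
  · intro t s
    simp [dotProduct_add, hνu]
  · intro t s
    rw [((hasDerivAt_dotProduct (dν t) (hasDerivAt_const t (γ t + s • u t))).fun_sub
      (hasDerivAt_dotProduct (dν t) (dγ t))).deriv]
    simp [dotProduct_add, hνu, hN1u]
  · have e := hfd.comp_hasDerivAt (f := fun t : ℝ => (t, (0 : ℝ))) (0 : ℝ)
      ((hasDerivAt_id (0 : ℝ)).prodMk (hasDerivAt_const (0 : ℝ) (0 : ℝ)))
    refine e.unique ?_
    have := dγ 0
    rw [hc0, zero_smul] at this
    simpa [Function.comp_def] using this
  · have e := hfd.comp_hasDerivAt (f := fun s : ℝ => ((0 : ℝ), s)) (0 : ℝ)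
      ((hasDerivAt_const (0 : ℝ) (0 : ℝ)).prodMk (hasDerivAt_id (0 : ℝ)))
    have e2 : HasDerivAt (fun s : ℝ => γ 0 + s • u 0) (u 0) 0 := by
      simpa using ((hasDerivAt_id (0 : ℝ)).smul_const (u 0)).const_add (γ 0)
    rw [e.unique e2]
    exact hu0

lemma LocallyDiffeomorphic.of_comp_add {E F : Type*} [NormedAddCommGroup E] [NormedSpace ℝ E]
    [NormedAddCommGroup F] [NormedSpace ℝ F] {f g : E → F} {a q : E}
    (h : LocallyDiffeomorphic (fun x => f (x + a)) 0 g q) : LocallyDiffeomorphic f a g q := by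
  obtain ⟨σ, σi, τ, τi, U, W, hU, h0, hW, hfW, hσ, hτ, hσi, hτi, hσs, hτs, hq, hUW, hc⟩ := h
  have hs : ContDiff ℝ ∞ fun x : E => x - a := contDiff_id.sub contDiff_const
  have him : (fun x => σ (x - a)) '' ((fun x => x - a) ⁻¹' U) = σ '' U := by
    rw [← image_image σ (fun x => x - a), image_preimage_eq U (fun y => ⟨y + a, by simp⟩)]
  refine ⟨fun x => σ (x - a), fun y => σi y + a, τ, τi, (fun x => x - a) ⁻¹' U, W,
    hU.preimage hs.continuous, by simpa using h0, hW, by simpa using hfW,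
    hσ.comp hs.contDiffOn fun x hx => hx, hτ, fun x hx => by simp [hσi _ hx], hτi, ?_, hτs,
    by simpa using hq, ?_, fun x hx => by simpa using hc _ hx⟩
  · rw [him]
    exact hσs.add contDiffOn_const
  · rintro _ ⟨x, hx, rfl⟩
    exact hUW ⟨x - a, hx, by simp⟩

end TangentSurface

end SwallowtailGerm

/-- if `γ'(t₀) = 0`, `γ''(t₀), γ'''(t₀), γ''''(t₀)` are linearly
independent, and `γ' = c·u` with `u(t₀) ≠ 0`, `c(t₀) = 0`, `c'(t₀) ≠ 0`, then the
tangent surface `f(t,s) = γ(t) + s u(t)`, as a germ at `(t₀,0)`, is diffeomorphic to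
the swallowtail `(u,t) ↦ (u, t³+ut, t⁴+(2/3)ut²)`. -/
theorem stmt12 (γ : ℝ → Fin 3 → ℝ) (hγ : ContDiff ℝ (⊤ : ℕ∞) γ) (t₀ : ℝ)
    (u : ℝ → Fin 3 → ℝ) (hu : ContDiff ℝ (⊤ : ℕ∞) u) (c : ℝ → ℝ) (hc : ContDiff ℝ (⊤ : ℕ∞) c)
    (hcu : ∀ t, deriv γ t = c t • u t)
    (hγ' : deriv γ t₀ = 0) (hu0 : u t₀ ≠ 0) (hc0 : c t₀ = 0) (hc1 : deriv c t₀ ≠ 0)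
    (hindep : LinearIndependent ℝ
      ![iteratedDeriv 2 γ t₀, iteratedDeriv 3 γ t₀, iteratedDeriv 4 γ t₀])
    (f : ℝ × ℝ → Fin 3 → ℝ) (hf : f = fun p => γ p.1 + p.2 • u p.1)
    (g : ℝ × ℝ → Fin 3 → ℝ)
    (hg : g = fun p => ![p.1, p.2 ^ 3 + p.1 * p.2, p.2 ^ 4 + (2 / 3) * p.1 * p.2 ^ 2]) :
    LocallyDiffeomorphic f (t₀, 0) g (0, 0) := by
  have hs : ContDiff ℝ (⊤ : ℕ∞) fun t : ℝ => t + t₀ := contDiff_id.add contDiff_const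
  have key := SwallowtailGerm.locallyDiffeomorphic_tangentSurface
    (γ := fun t => γ (t + t₀)) (u := fun t => u (t + t₀)) (c := fun t => c (t + t₀))
    (hγ.comp hs) (hu.comp hs) (hc.comp hs)
    (fun t => by rw [deriv_comp_add_const, hcu]) (by simpa using hu0) (by simpa using hc0)
    (by rw [deriv_comp_add_const]; simpa using hc1)
    (by simpa [iteratedDeriv_comp_add_const] using hindep)
  subst hf hg
  refine SwallowtailGerm.LocallyDiffeomorphic.of_comp_add ?_
  simp only [Prod.fst_add, Prod.snd_add, add_zero]
  exact key
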